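/- Let (S(t))_{t≥0} and (T(t))_{t≥0} both satisfy Assumption S, with upper Lipschitz sets L^S_+, L^T_+ and upper Γ-generators A_Γ⁺, B_Γ⁺ respectively. Let L^T := {f ∈ C_κ : T(t)f ∈ C_κ for all t ≥ 0, T(s+t)f = T(s)(T(t)f) for all s,t ≥ 0, and ∃ h₀ > 0, c ≥ 0 with ‖T(h)f − f‖_κ ≤ c·h for all h ∈ [0,h₀]}, and let D(B) := {f ∈ L^T : Bf := lim_{h↓0} (T(h)f − f)/h exists in the mixed topology as an element of C_κ}. Let D ⊂ L^T ∩ L^S_+ be such that T(t)(D) ⊂ D for all t ≥ 0 and A_Γ⁺f ≤ B_Γ⁺f for all f ∈ D. Then S(t)f ≤ T(t)f pointwise for all t ≥ 0 and all f ∈ D ∩ D(B). -/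

import Mathlib

open Filter MeasureTheory Topology
open scoped ENNReal Topology

noncomputable section

def ecoe {X : Type*} (f : X → ℝ) : X → EReal := fun x => (f x : EReal)

variable {X : Type*} [MetricSpace X]

/-- membership in `C_κ` -/
def MemCk (κ : X → ℝ) (f : X → ℝ) : Prop :=
  Continuous f ∧ ∃ r : ℝ, ∀ x, |f x| * κ x ≤ r

/-- `‖f‖_κ ≤ r` -/
def CkBound (κ : X → ℝ) (r : ℝ) (f : X → ℝ) : Prop := ∀ x, |f x| * κ x ≤ r

/-- extended `κ`-norm of an `EReal`-valued function -/
def eknorm (κ : X → ℝ) (f : X → EReal) : ℝ≥0∞ :=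
  ⨆ x, (f x).abs * ENNReal.ofReal (κ x)

/-- positive part of an `EReal`-valued function -/
def epos {X : Type*} (f : X → EReal) : X → EReal := fun x => max (f x) 0

/-- membership in `U_κ` -/
def MemUk (κ : X → ℝ) (f : X → EReal) : Prop :=
  UpperSemicontinuous f ∧ (∀ x, f x < ⊤) ∧
    ∃ r : ℝ, ∀ x, max (f x) 0 * (κ x : EReal) ≤ (r : EReal)

/-- `Γ`-limsup of a sequence of functions -/
def gammaLimsup (f : ℕ → X → EReal) (x : X) : EReal :=
  ⨆ (u : ℕ → X) (_ : Tendsto u atTop (𝓝 x)),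
    Filter.limsup (fun n => f n (u n)) atTop

/-- `g = Γ-lim f_n` -/
def IsGammaLim (f : ℕ → X → EReal) (g : X → EReal) : Prop :=
  ∀ x : X,
    (∀ u : ℕ → X, Tendsto u atTop (𝓝 x) →
      Filter.limsup (fun n => f n (u n)) atTop ≤ g x) ∧
    (∃ u : ℕ → X, Tendsto u atTop (𝓝 x) ∧
      Tendsto (fun n => f n (u n)) atTop (𝓝 (g x)))

/-- `Γ`-limsup as `h ↓ 0` -/
def gammaLimsupZero (F : ℝ → X → EReal) (x : X) : EReal :=
  ⨆ (h : ℕ → ℝ) (_ : ∀ n, 0 < h n) (_ : Tendsto h atTop (𝓝 (0:ℝ))),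
    gammaLimsup (fun n => F (h n)) x

/-- `Γ`-limsup as `s → t`, `s ≥ 0` -/
def gammaLimsupAt (F : ℝ → X → EReal) (t : ℝ) (x : X) : EReal :=
  ⨆ (s : ℕ → ℝ) (_ : ∀ n, 0 ≤ s n) (_ : Tendsto s atTop (𝓝 t)),
    gammaLimsup (fun n => F (s n)) x

/-- Assumption S on a family of operators on `U_κ` -/
structure AssumptionS (κ : X → ℝ) (S : ℝ → (X → EReal) → (X → EReal)) : Prop where
  monotone : ∀ t, 0 ≤ t → ∀ f g, MemUk κ f → MemUk κ g →
    (∀ x, f x ≤ g x) → ∀ x, S t f x ≤ S t g x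
  convex : ∀ t, 0 ≤ t → ∀ f g, MemUk κ f → MemUk κ g → ∀ lam : ℝ, 0 ≤ lam → lam ≤ 1 →
    ∀ x, S t (fun y => (lam : EReal) * f y + ((1 - lam : ℝ) : EReal) * g y) x
      ≤ (lam : EReal) * S t f x + ((1 - lam : ℝ) : EReal) * S t g x
  zero : ∀ t, 0 ≤ t → ∀ x, S t (fun _ => (0 : EReal)) x = 0
  maps : ∀ t, 0 ≤ t → ∀ f, MemUk κ f → MemUk κ (S t f)
  contAbove : ∀ t, 0 ≤ t → ∀ (f : ℕ → X → EReal) (g : X → EReal),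
    (∀ n, MemUk κ (f n)) → MemUk κ g →
    (∀ x, Antitone fun n => f n x) → (∀ x, (⨅ n, f n x) = g x) →
    ∀ x, (⨅ n, S t (f n) x) = S t g x
  gammaUsc : ∀ t, 0 ≤ t → ∀ f, MemUk κ f →
    ∀ x, gammaLimsupAt (fun s => S s f) t x ≤ S t f x
  idZero : ∀ f, MemUk κ f → S 0 f = f
  bounded : ∀ r t : ℝ, 0 ≤ r → 0 ≤ t → ∃ C : ℝ≥0∞, C ≠ ⊤ ∧
    ∀ s, 0 ≤ s → s ≤ t → ∀ f : X → ℝ, MemCk κ f → CkBound κ r f →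
      eknorm κ (S s (ecoe f)) ≤ C

/-- an `EReal`-valued function which belongs to `C_κ` -/
def IsCk (κ : X → ℝ) (F : X → EReal) : Prop :=
  ∃ g : X → ℝ, MemCk κ g ∧ ∀ x, F x = (g x : EReal)

/-- the upper Lipschitz set `L^S_+` -/
def UpperLip (κ : X → ℝ) (S : ℝ → (X → EReal) → (X → EReal)) (f : X → ℝ) : Prop :=
  MemCk κ f ∧
  (∀ t, 0 ≤ t → IsCk κ (S t (ecoe f))) ∧
  (∀ s t, 0 ≤ s → 0 ≤ t → S (s + t) (ecoe f) = S s (S t (ecoe f))) ∧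
  ∃ h₀ > (0:ℝ), ∃ c ≥ (0:ℝ), ∀ h, 0 ≤ h → h ≤ h₀ → ∀ x,
    max (S h (ecoe f) x - (f x : EReal)) 0 * (κ x : EReal) ≤ ((c * h : ℝ) : EReal)

/-- the (two-sided) Lipschitz set `L^S` -/
def LipSet (κ : X → ℝ) (S : ℝ → (X → EReal) → (X → EReal)) (f : X → ℝ) : Prop :=
  MemCk κ f ∧
  (∀ t, 0 ≤ t → IsCk κ (S t (ecoe f))) ∧
  (∀ s t, 0 ≤ s → 0 ≤ t → S (s + t) (ecoe f) = S s (S t (ecoe f))) ∧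
  ∃ h₀ > (0:ℝ), ∃ c ≥ (0:ℝ), ∀ h, 0 ≤ h → h ≤ h₀ → ∀ x,
    (S h (ecoe f) x - (f x : EReal)).abs * ENNReal.ofReal (κ x) ≤ ENNReal.ofReal (c * h)

/-- difference quotient `(S(h)f - f)/h` -/
def diffQuot (S : ℝ → (X → EReal) → (X → EReal)) (f : X → ℝ) (h : ℝ) : X → EReal :=
  fun x => ((h⁻¹ : ℝ) : EReal) * (S h (ecoe f) x - (f x : EReal))

/-- the upper `Γ`-generator `A_Γ⁺` -/
def uppGen (S : ℝ → (X → EReal) → (X → EReal)) (f : X → ℝ) : X → EReal :=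
  fun x => gammaLimsupZero (fun h => diffQuot S f h) x

/-- `g = A_Γ f`, i.e. the `Γ`-limit of the difference quotients exists and equals `g` -/
def IsGammaDeriv (S : ℝ → (X → EReal) → (X → EReal)) (f : X → ℝ) (g : X → EReal) : Prop :=
  ∀ h : ℕ → ℝ, (∀ n, 0 < h n) → Tendsto h atTop (𝓝 (0:ℝ)) →
    IsGammaLim (fun n => diffQuot S f (h n)) g

/-- `g = Af` in the mixed topology -/
def MixedDeriv (κ : X → ℝ) (S : ℝ → (X → EReal) → (X → EReal)) (f : X → ℝ) (g : X → ℝ) : Prop :=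
  (∃ h₀ > (0:ℝ), ∃ r : ℝ, ∀ h, 0 < h → h ≤ h₀ → ∀ x,
      |h⁻¹ * ((S h (ecoe f) x).toReal - f x)| * κ x ≤ r) ∧
  ∀ K : Set X, IsCompact K → ∀ ε > (0:ℝ), ∃ h₀ > (0:ℝ), ∀ h, 0 < h → h ≤ h₀ → ∀ x ∈ K,
    |h⁻¹ * ((S h (ecoe f) x).toReal - f x) - g x| ≤ ε

/-- upper `ε`-parallel function -/
def parallel (κ : X → ℝ) (f : X → EReal) (ε : ℝ) : X → EReal :=
  fun x => (((κ x)⁻¹ : ℝ) : EReal) *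
    ((⨆ y ∈ Metric.closedBall x ε, max (f y * (κ y : EReal)) (((-ε⁻¹ : ℝ)) : EReal)) + (ε : EReal))

/-- upper semicontinuous envelope of the upper `ε`-parallel function -/
def parallelEnv (κ : X → ℝ) (f : X → EReal) (ε : ℝ) : X → EReal :=
  fun x => ⨅ (δ : ℝ) (_ : 0 < δ), ⨆ y ∈ Metric.closedBall x δ, parallel κ f ε y

end

noncomputable section

/-- truncation of an extended real to `ℝ≥0∞` -/
def erealToENNReal (x : EReal) : ℝ≥0∞ := if x = ⊤ then ⊤ else ENNReal.ofReal x.toReal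

/-- Lebesgue integral of an `EReal`-valued function on `(a,b]`, with values in `[-∞,∞]` -/
def eIntegral (a b : ℝ) (F : ℝ → EReal) : EReal :=
  ((∫⁻ s in Set.Ioc a b, erealToENNReal (max (F s) 0)) : ℝ≥0∞) -
  ((∫⁻ s in Set.Ioc a b, erealToENNReal (max (-F s) 0)) : ℝ≥0∞)

/-- convolution `f * μ` of an `EReal`-valued function with a measure -/
def econv {X : Type*} [NormedAddCommGroup X] [MeasurableSpace X]
    (μ : Measure X) (f : X → EReal) (x : X) : EReal :=
  ((∫⁻ y, erealToENNReal (max (f (x - y)) 0) ∂μ : ℝ≥0∞) : EReal) -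
  ((∫⁻ y, erealToENNReal (max (-f (x - y)) 0) ∂μ : ℝ≥0∞) : EReal)

/-- conjugate functional `φ*` -/
def dualConj {X : Type*} [MetricSpace X] [MeasurableSpace X]
    (κ : X → ℝ) (φ : (X → ℝ) → ℝ) (μ : Measure X) : EReal :=
  ⨆ f : {g : X → ℝ // MemCk κ g}, (((∫ x, f.1 x ∂μ) : ℝ) : EReal) - ((φ f.1 : ℝ) : EReal)

/-- the topology `σ(ca_κ⁺, C_κ)` on measures -/
def weakTopo {X : Type*} [MetricSpace X] [MeasurableSpace X] (κ : X → ℝ) :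
    TopologicalSpace (Measure X) :=
  TopologicalSpace.induced
    (fun μ => fun f : {g : X → ℝ // MemCk κ g} => ∫ x, f.1 x ∂μ) Pi.topologicalSpace

/-- `φ₁`, the extension of `φ` from `C_κ` to `U_κ` -/
def extUk {X : Type*} [MetricSpace X] (κ : X → ℝ) (φ : (X → ℝ) → ℝ) (f : X → EReal) : EReal :=
  ⨅ g : {g : X → ℝ // MemCk κ g ∧ ∀ x, f x ≤ (g x : EReal)}, ((φ g.1 : ℝ) : EReal)

end


/-- real-valued upper semicontinuous functions, bounded in the weighted norm -/
def URx {X : Type*} [MetricSpace X] (κ : X → ℝ) (f : X → ℝ) : Prop :=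
  UpperSemicontinuous f ∧ ∃ r : ℝ, ∀ x, |f x| * κ x ≤ r

structure RSx {X : Type*} [MetricSpace X] (κ : X → ℝ) (R : ℝ → (X → ℝ) → (X → ℝ)) : Prop where
  maps : ∀ t, 0 ≤ t → ∀ f, URx κ f → URx κ (R t f)
  mono : ∀ t, 0 ≤ t → ∀ f g, URx κ f → URx κ g → (∀ x, f x ≤ g x) → ∀ x, R t f x ≤ R t g x
  conv : ∀ t, 0 ≤ t → ∀ f g, URx κ f → URx κ g → ∀ lam : ℝ, 0 ≤ lam → lam ≤ 1 → ∀ x,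
    R t (fun y => lam * f y + (1 - lam) * g y) x ≤ lam * R t f x + (1 - lam) * R t g x
  cont : ∀ t, 0 ≤ t → ∀ (f : ℕ → X → ℝ) (g : X → ℝ), (∀ n, URx κ (f n)) → URx κ g →
    (∀ x, Antitone fun n => f n x) → (∀ n x, g x ≤ f n x) →
    (∀ x c, g x < c → ∃ n, f n x < c) → ∀ x c, R t g x < c → ∃ n, R t (f n) x < c
  bdd : ∀ r T : ℝ, ∃ C : ℝ, 0 ≤ C ∧ ∀ s, 0 ≤ s → s ≤ T → ∀ f, URx κ f → (∀ x, |f x| * κ x ≤ r) →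
    ∀ x, |R s f x| * κ x ≤ C
  zero : ∀ f, URx κ f → R 0 f = f

def realOp {X : Type*} (S : ℝ → (X → EReal) → (X → EReal)) (t : ℝ) (f : X → ℝ) : X → ℝ :=
  fun x => (S t (ecoe f) x).toReal

section
variable {X : Type*} [MetricSpace X] {κ : X → ℝ}

lemma URx.of_cont {f : X → ℝ} (h : MemCk κ f) : URx κ f := ⟨h.1.upperSemicontinuous, h.2⟩

lemma URx.memUk (hκ : ∀ x, 0 < κ x) {f : X → ℝ} (h : URx κ f) : MemUk κ (ecoe f) := by
  refine ⟨?_, fun x => EReal.coe_lt_top _, ?_⟩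
  · exact continuous_coe_real_ereal.comp_upperSemicontinuous h.1
      (fun a b hab => EReal.coe_le_coe_iff.2 hab)
  · obtain ⟨r, hr⟩ := h.2
    refine ⟨r, fun x => ?_⟩
    have : max (ecoe f x) 0 = ((max (f x) 0 : ℝ) : EReal) := by
      rcases le_total (f x) 0 with h0 | h0
      · rw [max_eq_right h0, max_eq_right (by simpa [ecoe] using h0)]; rfl
      · rw [max_eq_left h0, max_eq_left (by simpa [ecoe] using h0)]; rfl
    rw [this, ← EReal.coe_mul, EReal.coe_le_coe_iff]
    refine le_trans ?_ (hr x)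
    exact mul_le_mul_of_nonneg_right (max_le (le_abs_self _) (abs_nonneg _)) (hκ x).le

lemma invk_mem (hκc : Continuous κ) (hκ : ∀ x, 0 < κ x) (r : ℝ) :
    MemCk κ (fun x => r / κ x) := by
  refine ⟨continuous_const.div hκc (fun x => (hκ x).ne'), |r|, fun x => ?_⟩
  rw [abs_div, abs_of_pos (hκ x), div_mul_cancel₀ _ (hκ x).ne']

lemma eknorm_real (hκ : ∀ x, 0 < κ x) {F : X → EReal} {C : ℝ≥0∞} (hC : C ≠ ⊤)
    (h : eknorm κ F ≤ C) (x : X) :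
    F x = ((F x).toReal : EReal) ∧ |(F x).toReal| * κ x ≤ C.toReal := by
  have h1 : (F x).abs * ENNReal.ofReal (κ x) ≤ C :=
    le_trans (le_iSup (fun x => (F x).abs * ENNReal.ofReal (κ x)) x) h
  have hk : ENNReal.ofReal (κ x) ≠ 0 := by simpa using hκ x
  have hfin : (F x).abs ≠ ⊤ := by
    intro h2
    rw [h2, ENNReal.top_mul hk] at h1
    exact hC (top_le_iff.1 h1)
  have h3 : F x = ((F x).toReal : EReal) := by
    rw [EReal.coe_toReal]
    · intro h4; rw [h4] at hfin; simp at hfin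
    · intro h4; rw [h4] at hfin; simp at hfin
  refine ⟨h3, ?_⟩
  rw [h3, EReal.abs_def, ← ENNReal.ofReal_mul (abs_nonneg _)] at h1
  exact (ENNReal.ofReal_le_iff_le_toReal hC).1 h1

lemma realOp_bdd (hκc : Continuous κ) (hκ : ∀ x, 0 < κ x)
    {S : ℝ → (X → EReal) → (X → EReal)} (hS : AssumptionS κ S) (r T : ℝ) :
    ∃ C : ℝ, 0 ≤ C ∧ ∀ s, 0 ≤ s → s ≤ T → ∀ f, URx κ f → (∀ x, |f x| * κ x ≤ r) →
    ∀ x, S s (ecoe f) x = (realOp S s f x : EReal) ∧ |realOp S s f x| * κ x ≤ C := by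
  obtain ⟨C, hC, hb⟩ := hS.bounded |r| |T| (abs_nonneg _) (abs_nonneg _)
  refine ⟨C.toReal, ENNReal.toReal_nonneg, fun s hs hsT f hf hfr x => ?_⟩
  have hp := invk_mem hκc hκ |r|
  have hm := invk_mem hκc hκ (-|r|)
  have e1 := eknorm_real hκ hC (hb s hs (hsT.trans (le_abs_self _)) _ hp (fun x => by
    rw [abs_div, abs_of_pos (hκ x), div_mul_cancel₀ _ (hκ x).ne', abs_abs])) x
  have e2 := eknorm_real hκ hC (hb s hs (hsT.trans (le_abs_self _)) _ hm (fun x => by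
    rw [abs_div, abs_of_pos (hκ x), div_mul_cancel₀ _ (hκ x).ne', abs_neg, abs_abs])) x
  have hle : ∀ y, |f y| ≤ |r| / κ y := fun y => by
    rw [le_div_iff₀ (hκ y)]; exact (hfr y).trans (le_abs_self _)
  have m1 := hS.monotone s hs _ _ (hf.memUk hκ) ((URx.of_cont hp).memUk hκ) (fun y => by
    simp only [ecoe, EReal.coe_le_coe_iff]; exact (le_abs_self _).trans (hle y)) x
  have m2 := hS.monotone s hs _ _ ((URx.of_cont hm).memUk hκ) (hf.memUk hκ) (fun y => by
    simp only [ecoe, EReal.coe_le_coe_iff]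
    have := neg_abs_le (f y); have h2 := hle y
    rw [neg_div]; linarith) x
  rw [e1.1] at m1
  rw [e2.1] at m2
  have h3 : S s (ecoe f) x = (realOp S s f x : EReal) := by
    rw [realOp, EReal.coe_toReal]
    · intro h4; rw [h4] at m1; exact absurd m1 (by simp)
    · intro h4; rw [h4] at m2; exact absurd m2 (by simp)
  refine ⟨h3, ?_⟩
  rw [h3, EReal.coe_le_coe_iff] at m1 m2
  have a1 := (mul_le_mul_of_nonneg_right (le_abs_self _) (hκ x).le).trans e1.2
  rw [← abs_of_pos (hκ x), ← abs_mul, abs_le]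
  have := e2.2
  have b1 := mul_le_mul_of_nonneg_right m1 (hκ x).le
  have b2 := mul_le_mul_of_nonneg_right m2 (hκ x).le
  have b3 := mul_le_mul_of_nonneg_right (neg_abs_le (S s (ecoe fun x => -|r| / κ x) x).toReal) (hκ x).le
  constructor <;> linarith

lemma realOp_coe (hκc : Continuous κ) (hκ : ∀ x, 0 < κ x)
    {S : ℝ → (X → EReal) → (X → EReal)} (hS : AssumptionS κ S) {t : ℝ} (ht : 0 ≤ t)
    {f : X → ℝ} (hf : URx κ f) : S t (ecoe f) = ecoe (realOp S t f) := by
  obtain ⟨r, hr⟩ := hf.2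
  obtain ⟨C, -, h⟩ := realOp_bdd hκc hκ hS r t
  funext x
  exact (h t ht le_rfl f hf hr x).1

lemma realOp_RSx (hκc : Continuous κ) (hκ : ∀ x, 0 < κ x)
    {S : ℝ → (X → EReal) → (X → EReal)} (hS : AssumptionS κ S) : RSx κ (realOp S) := by
  have hc := @realOp_coe X _ κ hκc hκ S hS
  have hcx : ∀ {t : ℝ} (ht : 0 ≤ t) {f : X → ℝ} (hf : URx κ f) (x : X),
      S t (ecoe f) x = (realOp S t f x : EReal) := fun ht f hf x => congrFun (hc ht hf) x
  have hcomb : ∀ (f g : X → ℝ) (lam : ℝ), URx κ f → URx κ g → 0 ≤ lam → lam ≤ 1 →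
      URx κ (fun y => lam * f y + (1 - lam) * g y) := by
    intro f g lam hf hg h0 h1
    refine ⟨?_, ?_⟩
    · refine UpperSemicontinuous.add ?_ ?_
      · exact (continuous_const.mul continuous_id).comp_upperSemicontinuous hf.1
          (fun a b hab => mul_le_mul_of_nonneg_left hab h0)
      · exact (continuous_const.mul continuous_id).comp_upperSemicontinuous hg.1
          (fun a b hab => mul_le_mul_of_nonneg_left hab (by linarith))
    · obtain ⟨r, hr⟩ := hf.2
      obtain ⟨q, hq⟩ := hg.2
      refine ⟨lam * r + (1 - lam) * q, fun x => ?_⟩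
      have h2 : |lam * f x + (1 - lam) * g x| ≤ lam * |f x| + (1 - lam) * |g x| := by
        refine (abs_add_le _ _).trans ?_
        rw [abs_mul, abs_mul, abs_of_nonneg h0, abs_of_nonneg (by linarith : 0 ≤ 1 - lam)]
      have h3 := mul_le_mul_of_nonneg_right h2 (hκ x).le
      have h4 := mul_le_mul_of_nonneg_left (hr x) h0
      have h5 := mul_le_mul_of_nonneg_left (hq x) (by linarith : 0 ≤ 1 - lam)
      nlinarith
  refine ⟨?_, ?_, ?_, ?_, ?_, ?_⟩
  · intro t ht f hf
    refine ⟨?_, ?_⟩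
    · have h1 := (hS.maps t ht _ (hf.memUk hκ)).1
      rw [hc ht hf] at h1
      intro x c hx
      have := h1 x (c : EReal) (by simpa [ecoe] using hx)
      filter_upwards [this] with y hy
      simpa [ecoe] using hy
    · obtain ⟨r, hr⟩ := hf.2
      obtain ⟨C, -, h⟩ := realOp_bdd hκc hκ hS r t
      exact ⟨C, fun x => (h t ht le_rfl f hf hr x).2⟩
  · intro t ht f g hf hg hfg x
    have := hS.monotone t ht _ _ (hf.memUk hκ) (hg.memUk hκ)
      (fun y => by simpa [ecoe] using hfg y) x
    rwa [hcx ht hf, hcx ht hg, EReal.coe_le_coe_iff] at this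
  · intro t ht f g hf hg lam h0 h1 x
    have h2 := hS.convex t ht _ _ (hf.memUk hκ) (hg.memUk hκ) lam h0 h1 x
    have h3 : (fun y => (lam : EReal) * ecoe f y + ((1 - lam : ℝ) : EReal) * ecoe g y)
        = ecoe (fun y => lam * f y + (1 - lam) * g y) := by
      funext y; simp only [ecoe]; norm_cast
    rw [h3, hcx ht hf, hcx ht hg, hcx ht (hcomb f g lam hf hg h0 h1)] at h2
    exact_mod_cast h2
  · intro t ht f g hf hg hanti hge hlim x c hxc
    have h1 := hS.contAbove t ht (fun n => ecoe (f n)) (ecoe g) (fun n => (hf n).memUk hκ)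
      (hg.memUk hκ) (fun x a b hab => by simpa [ecoe] using hanti x hab) (fun y => by
        refine le_antisymm ?_ (le_iInf fun n => by simpa [ecoe] using hge n y)
        refine EReal.le_of_forall_lt_iff_le.1 fun z hz => ?_
        obtain ⟨n, hn⟩ := hlim y z (by simpa [ecoe] using hz)
        exact (iInf_le _ n).trans (by simpa [ecoe] using hn.le)) x
    have h2 : (⨅ n, S t (ecoe (f n)) x) < (c : EReal) := by
      rw [h1, hcx ht hg]; exact_mod_cast hxc
    obtain ⟨n, hn⟩ := iInf_lt_iff.1 h2
    rw [hcx ht (hf n)] at hn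
    exact ⟨n, by exact_mod_cast hn⟩
  · intro r T
    obtain ⟨C, hC, h⟩ := realOp_bdd hκc hκ hS r T
    exact ⟨C, hC, fun s hs hsT f hf hfr x => (h s hs hsT f hf hfr x).2⟩
  · intro f hf
    funext x
    rw [realOp, hS.idZero _ (hf.memUk hκ)]; simp [ecoe]

end

/-- `Γ-limsup_{h ↓ 0} g h ≤ g0` for real functions -/
def GLex {X : Type*} [MetricSpace X] (g : ℝ → X → ℝ) (g0 : X → ℝ) : Prop :=
  ∀ x c, g0 x < c → ∃ δ > 0, ∀ h, 0 < h → h < δ → ∀ y, dist y x < δ → g h y < c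

section
variable {X : Type*} [MetricSpace X] {κ : X → ℝ}

lemma URx.add_smul (hκ : ∀ x, 0 < κ x) {v g : X → ℝ} (hv : URx κ v) (hg : URx κ g) {l : ℝ}
    (hl : 0 ≤ l) : URx κ (fun x => v x + l * g x) := by
  refine ⟨?_, ?_⟩
  · refine UpperSemicontinuous.add hv.1 ?_
    exact (continuous_const.mul continuous_id).comp_upperSemicontinuous hg.1
      (fun a b hab => mul_le_mul_of_nonneg_left hab hl)
  · obtain ⟨r, hr⟩ := hv.2
    obtain ⟨q, hq⟩ := hg.2
    refine ⟨r + l * q, fun x => ?_⟩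
    have h2 : |v x + l * g x| ≤ |v x| + l * |g x| := by
      refine (abs_add_le _ _).trans ?_
      rw [abs_mul, abs_of_nonneg hl]
    have h3 := mul_le_mul_of_nonneg_right h2 (hκ x).le
    have h4 := mul_le_mul_of_nonneg_left (hq x) hl
    have h5 := hr x
    nlinarith

lemma URx.sub_cont (hκ : ∀ x, 0 < κ x) {v g : X → ℝ} (hv : MemCk κ v) (hg : URx κ g) :
    URx κ (fun x => g x - v x) := by
  have h : URx κ (fun x => - v x) := by
    refine ⟨hv.1.neg.upperSemicontinuous, ?_⟩
    simpa using hv.2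
  have := hg.add_smul hκ h zero_le_one
  simpa [sub_eq_add_neg] using this

lemma URx.smul (hκ : ∀ x, 0 < κ x) {g : X → ℝ} (hg : URx κ g) {l : ℝ}
    (hl : 0 ≤ l) : URx κ (fun x => l * g x) := by
  have h0 : URx κ (fun _ => (0 : ℝ)) := ⟨continuous_const.upperSemicontinuous, 0, by simp⟩
  simpa using h0.add_smul hκ hg hl

lemma invk_UR (hκc : Continuous κ) (hκ : ∀ x, 0 < κ x) (r : ℝ) : URx κ (fun x => r / κ x) :=
  URx.of_cont (invk_mem hκc hκ r)

lemma GLex.add_smul {g : ℝ → X → ℝ} {g0 v : X → ℝ} (hg : GLex g g0) (hv : Continuous v) {l : ℝ}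
    (hl : 0 < l) : GLex (fun h x => v x + l * g h x) (fun x => v x + l * g0 x) := by
  intro x c hc
  set e := c - (v x + l * g0 x) with he
  have hepos : 0 < e := by simp only [he]; linarith
  obtain ⟨δ, hδ, h1⟩ := hg x (g0 x + e / (2 * l)) (by
    have : 0 < e / (2 * l) := by positivity
    linarith)
  obtain ⟨δ', hδ', h2⟩ := Metric.continuous_iff.1 hv x (e / 2) (by positivity)
  refine ⟨min δ δ', lt_min hδ hδ', fun h h0 hh y hy => ?_⟩
  have a1 := h1 h h0 (hh.trans_le (min_le_left _ _)) y (hy.trans_le (min_le_left _ _))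
  have a2 := h2 y (hy.trans_le (min_le_right _ _))
  rw [Real.dist_eq, abs_lt] at a2
  have a3 := mul_lt_mul_of_pos_left a1 hl
  have a4 : l * (g0 x + e / (2 * l)) = l * g0 x + e / 2 := by field_simp
  simp only
  linarith [a2.2]

lemma GLex.op (hκc : Continuous κ) (hκ : ∀ x, 0 < κ x) {R : ℝ → (X → ℝ) → (X → ℝ)}
    (hR : RSx κ R) {t : ℝ} (ht : 0 ≤ t) {g : ℝ → X → ℝ} {g0 : X → ℝ} {h0 C : ℝ} (hh0 : 0 < h0)
    (hg : ∀ h, 0 < h → h < h0 → URx κ (g h))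
    (hC : ∀ h, 0 < h → h < h0 → ∀ x, g h x * κ x ≤ C) (hg0 : URx κ g0) (hG : GLex g g0) :
    GLex (fun h => R t (g h)) (R t g0) := by
  obtain ⟨r0, hr0⟩ := hg0.2
  set K := max C r0 with hK
  -- families of majorants
  let Fam : ℕ → Set (X → ℝ) := fun n => {H | UpperSemicontinuous H ∧ (∀ x, g0 x ≤ H x) ∧
    ∀ h, 0 < h → h < h0 → h < 1 / ((n : ℝ) + 1) → ∀ x, g h x ≤ H x}
  have hgK : ∀ h, 0 < h → h < h0 → ∀ x, g h x ≤ K / κ x := fun h h1 h2 x => by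
    rw [le_div_iff₀ (hκ x)]; exact (hC h h1 h2 x).trans (le_max_left _ _)
  have hg0K : ∀ x, g0 x ≤ K / κ x := fun x => by
    rw [le_div_iff₀ (hκ x)]
    exact (mul_le_mul_of_nonneg_right (le_abs_self _) (hκ x).le).trans
      ((hr0 x).trans (le_max_right _ _))
  have hKc := (invk_mem hκc hκ K).1
  have hKmem : ∀ n, (fun x => K / κ x) ∈ Fam n := fun n =>
    ⟨hKc.upperSemicontinuous, hg0K, fun h h1 h2 _ x => hgK h h1 h2 x⟩
  let G : ℕ → X → ℝ := fun n x => ⨅ H : Fam n, H.1 x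
  have hne : ∀ n, Nonempty (Fam n) := fun n => ⟨⟨_, hKmem n⟩⟩
  have hbdd : ∀ n x, BddBelow (Set.range fun H : Fam n => H.1 x) := fun n x =>
    ⟨g0 x, by rintro _ ⟨H, rfl⟩; exact H.2.2.1 x⟩
  have hGle : ∀ n x H, H ∈ Fam n → G n x ≤ H x := fun n x H hH =>
    ciInf_le (hbdd n x) (⟨H, hH⟩ : Fam n)
  have hGge : ∀ n x, g0 x ≤ G n x := fun n x => by
    have := hne n
    exact le_ciInf fun H => H.2.2.1 x
  have hGg : ∀ (n : ℕ) (h : ℝ), 0 < h → h < h0 → h < 1 / ((n : ℝ) + 1) → ∀ x, g h x ≤ G n x :=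
    fun n h h1 h2 h3 x => by
      have := hne n
      exact le_ciInf fun H => H.2.2.2 h h1 h2 h3 x
  have hGUR : ∀ n, URx κ (G n) := fun n => by
    refine ⟨?_, |K| + r0, fun x => ?_⟩
    · intro x c hc
      have := hne n
      obtain ⟨H, hH⟩ := exists_lt_of_ciInf_lt hc
      filter_upwards [H.2.1 x c hH] with y hy
      exact (hGle n y _ H.2).trans_lt hy
    · have h1 := hGge n x
      have h2 := hGle n x _ (hKmem n)
      have h3 : G n x * κ x ≤ K := by rwa [le_div_iff₀ (hκ x)] at h2
      have h4 := mul_le_mul_of_nonneg_right h1 (hκ x).le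
      have h5 := mul_le_mul_of_nonneg_right (neg_abs_le (g0 x)) (hκ x).le
      have h6 := hr0 x
      have h7 : 0 ≤ |g0 x| * κ x := mul_nonneg (abs_nonneg _) (hκ x).le
      rw [← abs_of_pos (hκ x), ← abs_mul, abs_le]
      have := le_abs_self K
      have := abs_nonneg K
      constructor <;> linarith
  have hanti : ∀ x, Antitone fun n => G n x := fun x m n hmn => by
    have := hne m
    refine le_ciInf fun H => hGle n x H.1 ⟨H.2.1, H.2.2.1, fun h h1 h2 h3 => H.2.2.2 h h1 h2 ?_⟩
    exact h3.trans_le (one_div_le_one_div_of_le (by positivity) (by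
      have : (m : ℝ) ≤ n := by exact_mod_cast hmn
      linarith))
  have hlim : ∀ x c, g0 x < c → ∃ n, G n x < c := by
    intro x c hc
    obtain ⟨c', h1, h2⟩ := exists_between hc
    obtain ⟨δ, hδ, hδg⟩ := hG x c' h1
    obtain ⟨ε, hε, hεg⟩ := Metric.eventually_nhds_iff.1 (hg0.1 x c' h1)
    obtain ⟨n, hn⟩ := exists_nat_one_div_lt hδ
    classical
    let ρ := min δ ε
    have hρ : 0 < ρ := lt_min hδ hε
    let H : X → ℝ := fun y => if dist y x < ρ then min c' (K / κ y) else K / κ y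
    have hHle : ∀ y, H y ≤ K / κ y := fun y => by
      simp only [H]; split_ifs
      · exact min_le_right _ _
      · exact le_rfl
    have hH : H ∈ Fam n := by
      refine ⟨?_, fun y => ?_, fun h a1 a2 a3 y => ?_⟩
      · intro z d hz
        by_cases hzx : dist z x < ρ
        · have hz' : min c' (K / κ z) < d := by simpa [H, hzx] using hz
          have o1 : ∀ᶠ y in 𝓝 z, dist y x < ρ :=
            (continuous_id.dist continuous_const).continuousAt.eventually_lt_const hzx
          have o2 : ∀ᶠ y in 𝓝 z, min c' (K / κ y) < d :=
            (continuous_const.min hKc).continuousAt.eventually_lt_const hz'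
          filter_upwards [o1, o2] with y b1 b2
          simpa [H, b1] using b2
        · have hz' : K / κ z < d := by simpa [H, hzx] using hz
          have o2 : ∀ᶠ y in 𝓝 z, K / κ y < d := hKc.continuousAt.eventually_lt_const hz'
          filter_upwards [o2] with y b2
          exact (hHle y).trans_lt b2
      · simp only [H]; split_ifs with hy
        · exact le_min (hεg (hy.trans_le (min_le_right _ _))).le (hg0K y)
        · exact hg0K y
      · simp only [H]; split_ifs with hy
        · exact le_min (hδg h a1 (a3.trans hn) y (hy.trans_le (min_le_left _ _))).le
            (hgK h a1 a2 y)
        · exact hgK h a1 a2 y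
    refine ⟨n, (hGle n x H hH).trans_lt ?_⟩
    have : H x ≤ c' := by simp [H, hρ]
    exact this.trans_lt h2
  intro x c hc
  obtain ⟨n, hn⟩ := hR.cont t ht G g0 hGUR hg0 hanti hGge hlim x c hc
  obtain ⟨ε, hε, hεg⟩ := Metric.eventually_nhds_iff.1 ((hR.maps t ht _ (hGUR n)).1 x c hn)
  have hp : (0:ℝ) < 1 / ((n : ℝ) + 1) := by positivity
  refine ⟨min ε (min h0 (1 / ((n : ℝ) + 1))), lt_min hε (lt_min hh0 hp), fun h a1 a2 y hy => ?_⟩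
  have b1 : h < h0 := a2.trans_le ((min_le_right _ _).trans (min_le_left _ _))
  have b2 : h < 1 / ((n : ℝ) + 1) := a2.trans_le ((min_le_right _ _).trans (min_le_right _ _))
  refine (hR.mono t ht _ _ (hg h a1 b1) (hGUR n) (hGg n h a1 b1 b2) y).trans_lt ?_
  exact hεg (hy.trans_le (min_le_left _ _))

lemma RSx.slope (hκ : ∀ x, 0 < κ x) {R : ℝ → (X → ℝ) → (X → ℝ)} (hR : RSx κ R) {t : ℝ} (ht : 0 ≤ t)
    {v g : X → ℝ} (hv : URx κ v) (hg : URx κ g) {h l : ℝ} (hh : 0 ≤ h) (hl : 0 < l) (hhl : h ≤ l)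
    (x : X) :
    R t (fun y => v y + h * g y) x - R t v x ≤
      h / l * (R t (fun y => v y + l * g y) x - R t v x) := by
  have := hR.conv t ht _ _ (hv.add_smul hκ hg hl.le) hv (h / l) (by positivity)
    (by rw [div_le_one hl]; exact hhl) x
  have e : (fun y => h / l * (v y + l * g y) + (1 - h / l) * v y) = fun y => v y + h * g y := by
    funext y; field_simp; ring
  rw [e] at this
  linarith

/-- two-sided Lipschitz estimate -/
lemma RSx.lip (hκc : Continuous κ) (hκ : ∀ x, 0 < κ x) {R : ℝ → (X → ℝ) → (X → ℝ)} (hR : RSx κ R)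
    (r T : ℝ) : ∃ C : ℝ, 0 ≤ C ∧ ∀ t, 0 ≤ t → t ≤ T → ∀ v g, URx κ v → URx κ g →
      (∀ x, |v x| * κ x ≤ r) → (∀ x, |g x| * κ x ≤ r) → ∀ h, 0 ≤ h → h ≤ 1 → ∀ x,
      |R t (fun y => v y + h * g y) x - R t v x| * κ x ≤ C * h := by
  obtain ⟨C, hC0, hC⟩ := hR.bdd (r + r) T
  refine ⟨C + C, by positivity, fun t ht htT v g hv hg hvr hgr h h0 h1 x => ?_⟩
  have hkr := invk_UR hκc hκ r
  have hr0 : 0 ≤ r := (mul_nonneg (abs_nonneg _) (hκ x).le).trans (hvr x)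
  have hvC := hC t ht htT v hv (fun y => (hvr y).trans (by linarith)) x
  have hb : ∀ y, |v y + 1 * (r / κ y)| * κ y ≤ r + r := fun y => by
    have h2 : |v y + 1 * (r / κ y)| ≤ |v y| + r / κ y := by
      refine (abs_add_le _ _).trans ?_
      rw [one_mul, abs_of_nonneg (div_nonneg hr0 (hκ y).le)]
    have h3 := mul_le_mul_of_nonneg_right h2 (hκ y).le
    rw [add_mul, div_mul_cancel₀ _ (hκ y).ne'] at h3
    linarith [hvr y]
  have hbC := hC t ht htT _ (hv.add_smul hκ hkr zero_le_one) hb x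
  have hgle : ∀ y, |g y| ≤ r / κ y := fun y => by rw [le_div_iff₀ (hκ y)]; exact hgr y
  set P := R t (fun y => v y + 1 * (r / κ y)) x
  set V := R t v x
  -- upper
  have u1 := hR.slope hκ ht hv hkr h0 zero_lt_one h1 x
  rw [div_one] at u1
  have u2 := hR.mono t ht _ _ (hv.add_smul hκ hg h0) (hv.add_smul hκ hkr h0) (fun y => by
    have := mul_le_mul_of_nonneg_left ((le_abs_self _).trans (hgle y)) h0
    linarith) x
  -- lower
  have l2 := hR.mono t ht _ _ (hv.add_smul hκ (invk_UR hκc hκ (-r)) h0) (hv.add_smul hκ hg h0)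
    (fun y => by
      have h3 : -(r / κ y) ≤ g y := (neg_le_neg (hgle y)).trans (neg_abs_le _)
      have := mul_le_mul_of_nonneg_left h3 h0
      rw [neg_div]; linarith) x
  have l1 := hR.conv t ht _ _ (hv.add_smul hκ (invk_UR hκc hκ (-r)) h0)
    (hv.add_smul hκ hkr zero_le_one) (1 / (1 + h)) (by positivity)
    (by rw [div_le_one (by linarith)]; linarith) x
  have e : (fun y => 1 / (1 + h) * (v y + h * (-r / κ y)) +
      (1 - 1 / (1 + h)) * (v y + 1 * (r / κ y))) = v := by
    funext y
    have := (hκ y).ne'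
    have : 1 + h ≠ 0 := by linarith
    field_simp; ring
  rw [e] at l1
  have l3 : (1 + h) * V ≤ R t (fun y => v y + h * (-r / κ y)) x + h * P := by
    have h4 := mul_le_mul_of_nonneg_left l1 (by linarith : 0 ≤ 1 + h)
    have h5 : (1 + h) * (1 / (1 + h) * R t (fun y => v y + h * (-r / κ y)) x +
      (1 - 1 / (1 + h)) * P) = R t (fun y => v y + h * (-r / κ y)) x + h * P := by
      have : 1 + h ≠ 0 := by linarith
      field_simp; ring
    linarith
  have k1 : |R t (fun y => v y + h * g y) x - V| ≤ h * |P - V| := by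
    have m1 := mul_le_mul_of_nonneg_left (le_abs_self (P - V)) h0
    rw [abs_le]
    constructor <;> nlinarith
  have k2 : |P - V| * κ x ≤ C + C := by
    have := mul_le_mul_of_nonneg_right (abs_sub P V) (hκ x).le
    nlinarith
  calc _ ≤ h * |P - V| * κ x := mul_le_mul_of_nonneg_right k1 (hκ x).le
    _ = h * (|P - V| * κ x) := by ring
    _ ≤ h * (C + C) := mul_le_mul_of_nonneg_left k2 h0
    _ = _ := by ring

end

/-- directional derivative of a convex operator -/
noncomputable def dirDx {X : Type*} (R : ℝ → (X → ℝ) → (X → ℝ)) (t : ℝ) (v W : X → ℝ) (x : X) : ℝ :=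
  ⨅ l : Set.Ioc (0:ℝ) 1, (R t (fun y => v y + l.1 * W y) x - R t v x) / l.1

section
variable {X : Type*} [MetricSpace X] {κ : X → ℝ} {R : ℝ → (X → ℝ) → (X → ℝ)}

lemma RSx.lip1 (hκc : Continuous κ) (hκ : ∀ x, 0 < κ x) (hR : RSx κ R) {t : ℝ} (ht : 0 ≤ t)
    {v W : X → ℝ} (hv : URx κ v) (hW : URx κ W) :
    ∃ C : ℝ, ∀ l : Set.Ioc (0:ℝ) 1, ∀ x,
      |(R t (fun y => v y + l.1 * W y) x - R t v x) / l.1| * κ x ≤ C := by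
  obtain ⟨r1, hr1⟩ := hv.2
  obtain ⟨r2, hr2⟩ := hW.2
  obtain ⟨C, hC0, hC⟩ := hR.lip hκc hκ (max r1 r2) t
  refine ⟨C, fun l x => ?_⟩
  have := hC t ht le_rfl v W hv hW (fun x => (hr1 x).trans (le_max_left _ _))
    (fun x => (hr2 x).trans (le_max_right _ _)) l.1 l.2.1.le l.2.2 x
  rw [abs_div, abs_of_pos l.2.1, div_mul_eq_mul_div, div_le_iff₀ l.2.1]
  exact this

lemma dirDx_bdd (hκc : Continuous κ) (hκ : ∀ x, 0 < κ x) (hR : RSx κ R) {t : ℝ} (ht : 0 ≤ t)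
    {v W : X → ℝ} (hv : URx κ v) (hW : URx κ W) (x : X) :
    BddBelow (Set.range fun l : Set.Ioc (0:ℝ) 1 =>
      (R t (fun y => v y + l.1 * W y) x - R t v x) / l.1) := by
  obtain ⟨C, hC⟩ := hR.lip1 hκc hκ ht hv hW
  refine ⟨-(C / κ x), ?_⟩
  rintro _ ⟨l, rfl⟩
  have := hC l x
  rw [← le_div_iff₀ (hκ x)] at this
  exact (abs_le.1 this).1

instance : Nonempty (Set.Ioc (0:ℝ) 1) := ⟨⟨1, by simp⟩⟩

lemma dirDx_UR (hκc : Continuous κ) (hκ : ∀ x, 0 < κ x) (hR : RSx κ R) {t : ℝ} (ht : 0 ≤ t)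
    {v W : X → ℝ} (hv : URx κ v) (hW : URx κ W) (hRv : MemCk κ (R t v)) :
    URx κ (dirDx R t v W) := by
  have hb := dirDx_bdd hκc hκ hR ht hv hW
  refine ⟨?_, ?_⟩
  · intro x c hc
    obtain ⟨l, hl⟩ := exists_lt_of_ciInf_lt hc
    have h1 := ((URx.sub_cont hκ hRv (hR.maps t ht _ (hv.add_smul hκ hW l.2.1.le))).smul hκ
      (inv_nonneg.2 l.2.1.le)).1 x c (by
        show l.1⁻¹ * (R t (fun y => v y + l.1 * W y) x - R t v x) < c
        rw [← div_eq_inv_mul]; exact hl)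
    filter_upwards [h1] with y hy
    change l.1⁻¹ * (R t (fun y => v y + l.1 * W y) y - R t v y) < c at hy
    rw [← div_eq_inv_mul] at hy
    exact (ciInf_le (hb y) l).trans_lt hy
  · obtain ⟨C, hC⟩ := hR.lip1 hκc hκ ht hv hW
    refine ⟨C, fun x => ?_⟩
    rw [← le_div_iff₀ (hκ x), abs_le]
    refine ⟨le_ciInf fun l => ?_, (ciInf_le (hb x) ⟨1, by simp⟩).trans ?_⟩
    · have := hC l x
      rw [← le_div_iff₀ (hκ x)] at this
      exact (abs_le.1 this).1
    · have := hC ⟨1, by simp⟩ x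
      rw [← le_div_iff₀ (hκ x)] at this
      exact (abs_le.1 this).2

lemma dirDx_up (hκc : Continuous κ) (hκ : ∀ x, 0 < κ x) (hR : RSx κ R) {t : ℝ} (ht : 0 ≤ t)
    {v W : X → ℝ} (hv : MemCk κ v) (hW : URx κ W) (hRv : MemCk κ (R t v))
    {g : ℝ → X → ℝ} {h0 C : ℝ} (hh0 : 0 < h0) (hg : ∀ h, 0 < h → h < h0 → URx κ (g h))
    (hC : ∀ h, 0 < h → h < h0 → ∀ x, g h x * κ x ≤ C) (hG : GLex g W) :
    GLex (fun h x => (R t (fun y => v y + h * g h y) x - R t v x) / h) (dirDx R t v W) := by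
  have hvU := URx.of_cont hv
  intro x c hc
  obtain ⟨⟨l, hl0, hl1⟩, hl⟩ := exists_lt_of_ciInf_lt hc
  simp only at hl
  obtain ⟨r, hr⟩ := hv.2
  have h1 := GLex.op hκc hκ hR ht (g := fun h x => v x + l * g h x) (C := r + l * C) hh0
    (fun h a1 a2 => hvU.add_smul hκ (hg h a1 a2) hl0.le) (fun h a1 a2 x => by
      have b1 := mul_le_mul_of_nonneg_left (hC h a1 a2 x) hl0.le
      have b2 := (mul_le_mul_of_nonneg_right (le_abs_self (v x)) (hκ x).le).trans (hr x)
      nlinarith) (hvU.add_smul hκ hW hl0.le) (hG.add_smul hv.1 hl0)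
  have h2 := h1.add_smul (v := fun x => - (l⁻¹ * R t v x)) (continuous_const.mul hRv.1).neg
    (inv_pos.2 hl0) x c (by
      have : -(l⁻¹ * R t v x) + l⁻¹ * R t (fun x => v x + l * W x) x =
        (R t (fun y => v y + l * W y) x - R t v x) / l := by rw [div_eq_inv_mul]; ring
      show -(l⁻¹ * R t v x) + l⁻¹ * R t (fun x => v x + l * W x) x < c
      rw [this]; exact hl)
  obtain ⟨δ, hδ, hd⟩ := h2
  refine ⟨min δ (min h0 l), lt_min hδ (lt_min hh0 hl0), fun h a1 a2 y hy => ?_⟩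
  have b1 : h < h0 := a2.trans_le ((min_le_right _ _).trans (min_le_left _ _))
  have b2 : h < l := a2.trans_le ((min_le_right _ _).trans (min_le_right _ _))
  have h3 := hd h a1 (a2.trans_le (min_le_left _ _)) y (hy.trans_le (min_le_left _ _))
  have h4 := hR.slope hκ ht hvU (hg h a1 b1) a1.le hl0 b2.le y
  refine lt_of_le_of_lt ?_ h3
  rw [div_le_iff₀ a1]
  refine h4.trans (le_of_eq ?_)
  field_simp
  ring

lemma dirDx_low (hκc : Continuous κ) (hκ : ∀ x, 0 < κ x) (hR : RSx κ R) {t : ℝ} (ht : 0 ≤ t)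
    {v W q E : X → ℝ} (hv : URx κ v) (hW : URx κ W) (hq : URx κ q) (hE : URx κ E) {h : ℝ}
    (h0 : 0 < h) (h1 : h < 1) (H : ∀ x, W x ≤ q x + E x / (1 - h)) (x : X) :
    dirDx R t v W x ≤ (R t (fun y => v y + h * q y) x - R t v x) / h +
      (R t (fun y => v y + 1 * E y) x - R t v x) / (1 - h) := by
  have h2 : 0 < 1 - h := by linarith
  have a1 : dirDx R t v W x ≤ (R t (fun y => v y + ((1 - h) * h) * W y) x - R t v x) / ((1 - h) * h) :=
    ciInf_le (dirDx_bdd hκc hκ hR ht hv hW x) ⟨(1 - h) * h, by positivity, by nlinarith⟩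
  have hq' := hv.add_smul hκ hq h0.le
  have hE' := hv.add_smul hκ hE zero_le_one
  have a2 := hR.conv t ht _ _ hq' hE' (1 - h) h2.le (by linarith) x
  have e : (fun y => (1 - h) * (v y + h * q y) + (1 - (1 - h)) * (v y + 1 * E y)) =
      fun y => v y + ((1 - h) * h) * (q y + (1 - h)⁻¹ * E y) := by
    funext y; field_simp; ring
  rw [e] at a2
  have a3 := hR.mono t ht (fun y => v y + ((1 - h) * h) * W y)
    (fun y => v y + ((1 - h) * h) * (q y + (1 - h)⁻¹ * E y))
    (hv.add_smul hκ hW (by positivity))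
    (hv.add_smul hκ (hq.add_smul hκ hE (by positivity)) (by positivity)) (fun y => by
      have := H y
      rw [div_eq_inv_mul] at this
      have := mul_le_mul_of_nonneg_left this (by positivity : 0 ≤ (1 - h) * h)
      linarith) x
  refine a1.trans ?_
  rw [div_le_iff₀ (by positivity)]
  have e2 : ((R t (fun y => v y + h * q y) x - R t v x) / h +
      (R t (fun y => v y + 1 * E y) x - R t v x) / (1 - h)) * ((1 - h) * h) =
      (1 - h) * (R t (fun y => v y + h * q y) x - R t v x) +
      h * (R t (fun y => v y + 1 * E y) x - R t v x) := by
    field_simp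
  rw [e2]
  linarith

lemma GLex.err (hκc : Continuous κ) (hκ : ∀ x, 0 < κ x) (hR : RSx κ R) {t : ℝ} (ht : 0 ≤ t)
    {v : X → ℝ} (hv : MemCk κ v) (hRv : MemCk κ (R t v)) {E : ℝ → X → ℝ} {h0 C : ℝ} (hh0 : 0 < h0)
    (hE : ∀ h, 0 < h → h < h0 → URx κ (E h))
    (hC : ∀ h, 0 < h → h < h0 → ∀ x, |E h x| * κ x ≤ C) (hG : GLex E (fun _ => 0)) :
    GLex (fun h x => R t (fun y => v y + 1 * E h y) x - R t v x) (fun _ => 0) ∧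
    (∀ h, 0 < h → h < h0 → URx κ (fun x => R t (fun y => v y + 1 * E h y) x - R t v x)) ∧
    ∃ C', ∀ h, 0 < h → h < h0 → ∀ x, |R t (fun y => v y + 1 * E h y) x - R t v x| * κ x ≤ C' := by
  have hvU := URx.of_cont hv
  obtain ⟨r, hr⟩ := hv.2
  refine ⟨?_, fun h a1 a2 => ?_, ?_⟩
  · have h1 := GLex.op hκc hκ hR ht (g := fun h x => v x + 1 * E h x) (g0 := v) (C := r + C) hh0
      (fun h a1 a2 => hvU.add_smul hκ (hE h a1 a2) zero_le_one) (fun h a1 a2 x => by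
        have b1 := (mul_le_mul_of_nonneg_right (le_abs_self (E h x)) (hκ x).le).trans (hC h a1 a2 x)
        have b2 := (mul_le_mul_of_nonneg_right (le_abs_self (v x)) (hκ x).le).trans (hr x)
        nlinarith) hvU (by simpa using hG.add_smul hv.1 zero_lt_one)
    have h2 := h1.add_smul (v := fun x => - R t v x) hRv.1.neg zero_lt_one
    have e1 : (fun h x => -R t v x + 1 * R t (fun x => v x + 1 * E h x) x) =
      (fun h x => R t (fun y => v y + 1 * E h y) x - R t v x) := by
      funext h x; ring
    have e2 : (fun x => -R t v x + 1 * R t v x) = fun _ => 0 := by funext x; ring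
    rw [e1, e2] at h2
    exact h2
  · exact URx.sub_cont hκ hRv (hR.maps t ht _ (hvU.add_smul hκ (hE h a1 a2) zero_le_one))
  · obtain ⟨C', hC'0, hC'⟩ := hR.lip hκc hκ (max r C) t
    refine ⟨C' * 1, fun h a1 a2 x => hC' t ht le_rfl v (E h) hvU (hE h a1 a2)
      (fun x => (hr x).trans (le_max_left _ _)) (fun x => (hC h a1 a2 x).trans (le_max_right _ _))
      1 zero_le_one le_rfl x⟩

/-- the infinitesimal comparison -/
lemma dini_compare (hκc : Continuous κ) (hκ : ∀ x, 0 < κ x) {S T : ℝ → (X → ℝ) → (X → ℝ)}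
    (hS : RSx κ S) (hT : RSx κ T) {f Bf : X → ℝ} (hf : MemCk κ f) (hBf : MemCk κ Bf)
    {b : ℝ → X → ℝ} {h0 r : ℝ} (hh0 : 0 < h0) (hb : ∀ h, 0 < h → h < h0 → MemCk κ (b h))
    (hbr : ∀ h, 0 < h → h < h0 → ∀ x, |b h x| * κ x ≤ r)
    (hG1 : GLex b Bf) (hG2 : GLex (fun h x => Bf x - b h x) (fun _ => 0))
    {s a : ℝ} (hs : 0 ≤ s) (ha : 0 ≤ a) {u : X → ℝ} (hu : T s f = u) (huC : MemCk κ u)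
    (hSu : MemCk κ (S a u)) {p : ℝ → X → ℝ} {c h2 : ℝ} (hh2 : 0 < h2)
    (hp : ∀ h, 0 < h → h < h2 → URx κ (p h))
    (hpc : ∀ h, 0 < h → h < h2 → ∀ x, p h x * κ x ≤ c)
    (hgen : ∀ W, GLex (fun h x => (T s (fun y => f y + h * b h y) x - u x) / h) W → GLex p W)
    (hqC : ∀ h, 0 < h → h < h0 → MemCk κ (T s (fun y => f y + h * b h y)))
    (x : X) {ε : ℝ} (hε : 0 < ε) :
    ∃ δ > 0, ∀ h, 0 < h → h < δ →
      S a (fun y => u y + h * p h y) x ≤ S a (T s (fun y => f y + h * b h y)) x + ε * h := by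
  have hfU := URx.of_cont hf
  have hBU := URx.of_cont hBf
  have huU := URx.of_cont huC
  obtain ⟨rB, hrB⟩ := hBf.2
  have hTf : MemCk κ (T s f) := by rw [hu]; exact huC
  set W := dirDx T s f Bf with hWdef
  have hWU : URx κ W := dirDx_UR hκc hκ hT hs hfU hBU hTf
  set k0 := min h0 (1 / 2) with hk0
  have hk0p : 0 < k0 := lt_min hh0 (by norm_num)
  have hk1 : ∀ {h}, h < k0 → h < h0 := fun h => h.trans_le (min_le_left _ _)
  have hk2 : ∀ {h}, h < k0 → h < 1 / 2 := fun h => h.trans_le (min_le_right _ _)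
  -- upper estimates
  have hqW := dirDx_up hκc hκ hT hs hf hBU hTf hh0 (fun h a1 a2 => URx.of_cont (hb h a1 a2))
    (fun h a1 a2 x => (mul_le_mul_of_nonneg_right (le_abs_self _) (hκ x).le).trans
      (hbr h a1 a2 x)) hG1
  rw [hu] at hqW
  have hpW := hgen _ hqW
  have hup := dirDx_up hκc hκ hS ha huC hWU hSu hh2 hp hpc hpW
  -- lower estimates
  let E1 : ℝ → X → ℝ := fun h x => (1 - h) * (Bf x - b h x)
  have hE1U : ∀ h, 0 < h → h < k0 → URx κ (E1 h) := fun h a1 a2 =>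
    (URx.sub_cont hκ (hb h a1 (hk1 a2)) hBU).smul hκ (by linarith [hk2 a2])
  have hE1C : ∀ h, 0 < h → h < k0 → ∀ x, |E1 h x| * κ x ≤ rB + r := fun h a1 a2 x => by
    have c1 := hk2 a2
    have c2 : |E1 h x| ≤ |Bf x| + |b h x| := by
      simp only [E1]
      rw [abs_mul, abs_of_pos (by linarith : 0 < 1 - h)]
      have := abs_sub (Bf x) (b h x)
      have h3 := abs_nonneg (Bf x - b h x)
      nlinarith
    have c3 := mul_le_mul_of_nonneg_right c2 (hκ x).le
    linarith [hrB x, hbr h a1 (hk1 a2) x]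
  have hE1G : GLex E1 (fun _ => 0) := by
    intro x c hc
    obtain ⟨δ, hδ, hd⟩ := hG2 x c hc
    refine ⟨min δ k0, lt_min hδ hk0p, fun h a1 a2 y hy => ?_⟩
    have c1 := hd h a1 (a2.trans_le (min_le_left _ _)) y (hy.trans_le (min_le_left _ _))
    have c2 := hk2 (a2.trans_le (min_le_right _ _))
    simp only [E1]
    simp only at hc
    nlinarith
  obtain ⟨hE2G, hE2U, C2, hE2C⟩ := GLex.err hκc hκ hT hs hf hTf hk0p hE1U hE1C hE1G
  rw [hu] at hE2G hE2U hE2C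
  obtain ⟨hE3G, -, -⟩ := GLex.err hκc hκ hS ha huC hSu hk0p hE2U hE2C hE2G
  have hlow1 : ∀ h, 0 < h → h < k0 → ∀ x, W x ≤ (T s (fun y => f y + h * b h y) x - u x) / h +
      (T s (fun y => f y + 1 * E1 h y) x - u x) / (1 - h) := by
    intro h a1 a2 x
    have c2 := hk2 a2
    have := dirDx_low hκc hκ hT hs hfU hBU (URx.of_cont (hb h a1 (hk1 a2))) (hE1U h a1 a2) a1
      (by linarith) (fun x => by
        simp only [E1]
        rw [mul_div_assoc, mul_div_cancel₀ _ (by linarith : 1 - h ≠ 0)]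
        linarith) x
    rwa [hu] at this
  obtain ⟨δ1, hδ1, hd1⟩ := hup x (dirDx S a u W x + ε / 2) (by linarith)
  obtain ⟨δ2, hδ2, hd2⟩ := hE3G x (ε / 4) (by positivity)
  refine ⟨min δ1 (min δ2 k0), lt_min hδ1 (lt_min hδ2 hk0p), fun h a1 a2 => ?_⟩
  have b1 : h < δ1 := a2.trans_le (min_le_left _ _)
  have b2 : h < δ2 := a2.trans_le ((min_le_right _ _).trans (min_le_left _ _))
  have b3 : h < k0 := a2.trans_le ((min_le_right _ _).trans (min_le_right _ _))
  have b4 := hk2 b3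
  have i1 := hd1 h a1 b1 x (by simpa using hδ1)
  have i2 := hd2 h a1 b2 x (by simpa using hδ2)
  have hqU : URx κ (fun x => (T s (fun y => f y + h * b h y) x - u x) / h) := by
    have := (URx.sub_cont hκ huC (URx.of_cont (hqC h a1 (hk1 b3)))).smul hκ (inv_nonneg.2 a1.le)
    simpa only [← div_eq_inv_mul] using this
  have i3 := dirDx_low hκc hκ hS ha huU hWU hqU (hE2U h a1 b3) a1 (by linarith)
    (hlow1 h a1 b3) x
  have e : (fun y => u y + h * ((T s (fun y => f y + h * b h y) y - u y) / h)) =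
      T s (fun y => f y + h * b h y) := by
    funext y; field_simp; ring
  rw [e] at i3
  have i4 : (S a (fun y => u y + 1 * (T s (fun y => f y + 1 * E1 h y) y - u y)) x - S a u x)
      / (1 - h) ≤ ε / 2 := by
    rw [div_le_iff₀ (by linarith)]
    nlinarith
  rw [div_lt_iff₀ a1] at i1
  have i5 : dirDx S a u W x - ε / 2 ≤ (S a (T s (fun y => f y + h * b h y)) x - S a u x) / h := by
    linarith
  rw [le_div_iff₀ a1] at i5
  nlinarith

end

section
open intervalIntegral

lemma chain_antitone {m : ℝ → ℝ} {C h0 t : ℝ} (hh0 : 0 < h0)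
    (H : ∀ a h, 0 ≤ a → a ≤ t → 0 ≤ h → h ≤ h0 → m (a + h) ≤ m a + C * h) :
    ∀ a b, 0 ≤ a → a ≤ b → b ≤ t → m b ≤ m a + C * (b - a) := by
  have key : ∀ n : ℕ, ∀ a b, 0 ≤ a → a ≤ b → b ≤ t → b - a ≤ n * h0 →
      m b ≤ m a + C * (b - a) := by
    intro n
    induction n with
    | zero =>
      intro a b h1 h2 h3 h4
      have : b = a := by simp at h4; linarith
      subst this; simp
    | succ n ih =>
      intro a b h1 h2 h3 h4
      rcases le_total (b - a) h0 with h | h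
      · have := H a (b - a) h1 (by linarith) (by linarith) h
        simpa using this
      · have i1 := H a h0 h1 (by linarith) hh0.le le_rfl
        have i2 := ih (a + h0) b (by linarith) (by linarith) h3 (by push_cast at h4; linarith)
        linarith
  intro a b h1 h2 h3
  obtain ⟨n, hn⟩ := exists_nat_ge ((b - a) / h0)
  exact key n a b h1 h2 h3 (by rwa [div_le_iff₀ hh0] at hn)

lemma progress_right {G : ℝ → ℝ} {T ε : ℝ} (hT : 0 ≤ T) 
    (hleft : ∀ s, 0 ≤ s → s ≤ T → ∃ C, ∃ δ > 0, ∀ r, 0 ≤ r → r ≤ s → s - r < δ →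
      G r ≤ G s + C * (s - r))
    (hright : ∀ s, 0 ≤ s → s < T → ∃ h > 0, s + h ≤ T ∧ G s - ε * h ≤ G (s + h)) :
    G 0 - ε * T ≤ G T := by
  let A : Set ℝ := {s | 0 ≤ s ∧ s ≤ T ∧ G 0 - ε * s ≤ G s}
  have h0A : (0:ℝ) ∈ A := ⟨le_rfl, hT, by simp⟩
  have hbd : BddAbove A := ⟨T, fun s hs => hs.2.1⟩
  set σ := sSup A
  have hσ0 : 0 ≤ σ := le_csSup hbd h0A
  have hσT : σ ≤ T := csSup_le ⟨0, h0A⟩ fun s hs => hs.2.1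
  have hσA : G 0 - ε * σ ≤ G σ := by
    obtain ⟨C, δ, hδ, hC⟩ := hleft σ hσ0 hσT
    refine le_of_forall_pos_le_add fun η hη => ?_
    set d := min δ (η / (|C| + |ε| + 1))
    have hd : 0 < d := lt_min hδ (by positivity)
    obtain ⟨r, hr, hrd⟩ := exists_lt_of_lt_csSup ⟨0, h0A⟩ (show σ - d < sSup A by
      change σ - d < σ; linarith)
    have hrσ : r ≤ σ := le_csSup hbd hr
    have h1 := hC r hr.1 hrσ (by have := min_le_left δ (η / (|C| + |ε| + 1)); linarith)
    have h2 := hr.2.2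
    have h3 : (|C| + |ε| + 1) * (σ - r) ≤ η := by
      have : σ - r ≤ η / (|C| + |ε| + 1) := by
        have := min_le_right δ (η / (|C| + |ε| + 1)); linarith
      rw [le_div_iff₀ (by positivity)] at this
      linarith
    have h4 : C * (σ - r) ≤ |C| * (σ - r) :=
      mul_le_mul_of_nonneg_right (le_abs_self _) (by linarith)
    have h5 : -ε * (σ - r) ≤ |ε| * (σ - r) :=
      mul_le_mul_of_nonneg_right (neg_le_abs _) (by linarith)
    nlinarith
  rcases hσT.lt_or_eq with hlt | heq
  · obtain ⟨h, hh, hhT, hG⟩ := hright σ hσ0 hlt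
    have : σ + h ∈ A := ⟨by linarith, hhT, by linarith⟩
    have := le_csSup hbd this
    change σ + h ≤ σ at this
    linarith
  · rwa [heq] at hσA

lemma final_real {m : ℝ → ℝ → ℝ} {t : ℝ} (ht : 0 < t) {L h1 : ℝ} (hL : 0 ≤ L) (hh1 : 0 < h1)
    (hlip : ∀ a s h, 0 ≤ a → a ≤ t → 0 ≤ s → s + h ≤ t → 0 ≤ h → h ≤ h1 →
      |m a (s + h) - m a s| ≤ L * h)
    (hup : ∀ s, 0 ≤ s → s ≤ t → ∃ C, 0 ≤ C ∧ ∀ a b, 0 ≤ a → a ≤ b → b ≤ t →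
      m b s ≤ m a s + C * (b - a))
    (hdini : ∀ a s ε, 0 ≤ a → a ≤ t → 0 ≤ s → s ≤ t → 0 < ε → ∃ δ > 0, ∀ h, 0 < h → h < δ →
      m (a + h) s ≤ m a (s + h) + ε * h) :
    m t 0 ≤ m 0 t := by
  have hint : ∀ s, 0 ≤ s → s ≤ t → ∀ p q, 0 ≤ p → p ≤ t → 0 ≤ q → q ≤ t →
      IntervalIntegrable (fun a => m a s) volume p q := by
    intro s hs hst p q hp hpt hq hqt
    obtain ⟨C, hC0, hC⟩ := hup s hs hst
    have h2 : AntitoneOn (fun a => m a s - C * a) (Set.uIcc p q) := by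
      intro a ha b hb hab
      have ha' : 0 ≤ a := (le_min hp hq).trans ha.1
      have hb' : b ≤ t := hb.2.trans (max_le hpt hqt)
      have := hC a b ha' hab hb'
      simp only; linarith
    have h3 := h2.intervalIntegrable (μ := volume)
    have h4 : IntervalIntegrable (fun a : ℝ => C * a) volume p q :=
      (continuous_const.mul continuous_id).intervalIntegrable _ _
    have := h3.add h4
    refine this.congr ?_
    intro a _
    simp
  -- main integrated inequality
  have main : ∀ δ, 0 < δ → δ < t →
      ∫ r in (0:ℝ)..δ, m (r + (t - δ)) 0 ≤ ∫ r in (0:ℝ)..δ, m r (t - δ) := by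
    intro δ hδ hδt
    set T := t - δ with hT
    have hT0 : 0 < T := by linarith
    let G : ℝ → ℝ := fun s => ∫ r in (T - s)..(T - s + δ), m r s
    have hG0 : G 0 = ∫ r in (0:ℝ)..δ, m (r + T) 0 := by
      simp only [G]
      rw [integral_comp_add_right (fun a => m a 0)]
      congr 1 <;> ring
    have hGT : G T = ∫ r in (0:ℝ)..δ, m r T := by simp [G]
    rw [← hG0, ← hGT]
    have hleft : ∀ s, 0 ≤ s → s ≤ T → ∃ C, ∃ δ > 0, ∀ r, 0 ≤ r → r ≤ s → s - r < δ →
        G r ≤ G s + C * (s - r) := by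
      intro s hs hsT
      obtain ⟨C, hC0, hC⟩ := hup s hs (by linarith)
      refine ⟨(C + L) * δ, h1, hh1, fun r hr hrs hsr => ?_⟩
      have e1 : G r = ∫ a in (T - s)..(T - s + δ), m (a + (s - r)) r := by
        simp only [G]
        rw [integral_comp_add_right (fun a => m a r)]
        congr 1 <;> ring
      have e2 : G s + (C + L) * δ * (s - r) =
          ∫ a in (T - s)..(T - s + δ), (m a s + (C + L) * (s - r)) := by
        rw [integral_add (hint s hs (by linarith) _ _ (by linarith) (by linarith) (by linarith)
          (by linarith)) (by simp)]
        simp [G]; ring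
      rw [e1, e2]
      refine integral_mono_on (by linarith) ?_ ?_ ?_
      · have := (hint r hr (by linarith) (T - s + (s - r)) (T - s + δ + (s - r)) (by linarith)
          (by linarith) (by linarith) (by linarith)).comp_add_right (s - r)
        simpa using this
      · exact (hint s hs (by linarith) _ _ (by linarith) (by linarith) (by linarith)
          (by linarith)).add (by simp)
      · intro a ha
        have q1 := hlip (a + (s - r)) r (s - r) (by linarith [ha.1]) (by linarith [ha.2]) hr
          (by linarith) (by linarith) hsr.le
        rw [add_sub_cancel] at q1
        have q2 := hC a (a + (s - r)) (by linarith [ha.1]) (by linarith) (by linarith [ha.2])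
        have q3 := (abs_le.1 q1).1
        have q4 : C * (a + (s - r) - a) = C * (s - r) := by ring
        nlinarith
    have hright : ∀ ε > 0, ∀ s, 0 ≤ s → s < T → ∃ h > 0, s + h ≤ T ∧
        G s - ε * h ≤ G (s + h) := by
      intro ε hε s hs hsT
      obtain ⟨C, hC0, hC⟩ := hup s hs (by linarith)
      set β := T - s with hβ
      have hβ0 : 0 < β := by linarith
      let F : ℝ → ℝ → ℝ := fun h a => m a (s + h) - m (a + h) s
      have hFint : ∀ h, 0 < h → h < min h1 (min δ β) → ∀ p q, 0 ≤ p → p ≤ t - h → 0 ≤ q → q ≤ t - h →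
          IntervalIntegrable (F h) volume p q := by
        intro h hh0 hh p q hp hpt hq hqt
        have hhβ : h < β := hh.trans_le ((min_le_right _ _).trans (min_le_right _ _))
        refine (hint (s + h) (by linarith) (by linarith) p q hp (by linarith) hq
          (by linarith)).sub ?_
        have := (hint s hs (by linarith) (p + h) (q + h) (by linarith)
          (by linarith) (by linarith) (by linarith)).comp_add_right h
        simpa using this
      have hFlow : ∀ h, 0 < h → h < min h1 (min δ β) → ∀ a, 0 ≤ a → a ≤ t - h →
          -(C + L) * h ≤ F h a := by
        intro h hh0 hh a ha hat
        have hhβ : h < β := hh.trans_le ((min_le_right _ _).trans (min_le_right _ _))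
        have q1 := hlip a s h ha (by linarith) hs (by linarith) hh0.le
          (hh.le.trans (min_le_left _ _))
        have q2 := hC a (a + h) ha (by linarith) (by linarith)
        have q3 := (abs_le.1 q1).1
        simp only [F]
        nlinarith
      -- truncated quotients
      let Φ : ℝ → ℝ → ℝ := fun h a => if a ≤ β + δ - h then min (F h a / h) 0 else 0
      have hDCT : Tendsto (fun h => ∫ a in β..(β + δ), Φ h a) (𝓝[>] 0)
          (𝓝 (∫ a in β..(β + δ), (0:ℝ))) := by
        have hsmall : ∀ᶠ h in 𝓝[>] (0:ℝ), 0 < h ∧ h < min h1 (min δ β) := by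
          have : Set.Ioo (0:ℝ) (min h1 (min δ β)) ∈ 𝓝[>] (0:ℝ) :=
            Ioo_mem_nhdsGT (lt_min hh1 (lt_min hδ hβ0))
          filter_upwards [this] with h hh using ⟨hh.1, hh.2⟩
        refine tendsto_integral_filter_of_dominated_convergence (fun _ => C + L) ?_ ?_ ?_ ?_
        · filter_upwards [hsmall] with h hh
          have hhδ : h < δ := hh.2.trans_le ((min_le_right _ _).trans (min_le_left _ _))
          have i1 := hFint h hh.1 hh.2 β (β + δ - h) hβ0.le (by linarith) (by linarith)
            (by linarith)
          rw [intervalIntegrable_iff_integrableOn_Ioc_of_le (by linarith)] at i1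
          have i2 : AEStronglyMeasurable (fun a => min (F h a / h) 0)
              (volume.restrict (Set.Ioc β (β + δ - h))) :=
            (i1.1.aemeasurable.div_const h |>.min aemeasurable_const).aestronglyMeasurable
          have i3 : AEStronglyMeasurable ((Set.Iic (β + δ - h)).indicator
              (fun a => min (F h a / h) 0)) (volume.restrict (Set.uIoc β (β + δ))) := by
            rw [aestronglyMeasurable_indicator_iff measurableSet_Iic,
              Measure.restrict_restrict measurableSet_Iic]
            refine i2.mono_measure (Measure.restrict_mono ?_ le_rfl)
            intro a ha
            rw [Set.uIoc_of_le (by linarith)] at ha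
            exact ⟨ha.2.1, ha.1⟩
          refine i3.congr ?_
          filter_upwards with a
          simp [Φ, Set.indicator]
        · filter_upwards [hsmall] with h hh
          filter_upwards with a ha
          rw [Set.uIoc_of_le (by linarith)] at ha
          simp only [Φ]
          split_ifs with hah
          · have := hFlow h hh.1 hh.2 a (by linarith [ha.1]) (by linarith)
            have h6 : -(C + L) ≤ F h a / h := by rw [le_div_iff₀ hh.1]; exact this
            rw [Real.norm_eq_abs, abs_le]
            exact ⟨le_min h6 (by linarith), (min_le_right _ _).trans (by linarith)⟩
          · simp; positivity
        · simp
        · filter_upwards with a ha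
          rw [Set.uIoc_of_le (by linarith)] at ha
          rw [Metric.tendsto_nhds]
          intro e he
          obtain ⟨d, hd, hd'⟩ := hdini a s (e / 2) (by linarith [ha.1]) (by linarith [ha.2]) hs
            (by linarith) (by positivity)
          have : Set.Ioo (0:ℝ) d ∈ 𝓝[>] (0:ℝ) := Ioo_mem_nhdsGT hd
          filter_upwards [this] with h hh
          have h7 := hd' h hh.1 hh.2
          have h8 : -(e / 2) ≤ F h a / h := by
            rw [le_div_iff₀ hh.1]; simp only [F]; linarith
          simp only [Φ]
          rw [Real.dist_eq, sub_zero]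
          split_ifs
          · rw [abs_lt]
            exact ⟨lt_of_lt_of_le (by linarith) (le_min h8 (by linarith)),
              (min_le_right _ _).trans_lt he⟩
          · simpa using he
      rw [intervalIntegral.integral_zero] at hDCT
      have hsm2 : ∀ᶠ h in 𝓝[>] (0:ℝ), 0 < h ∧ h < min (min h1 (min δ β)) (ε / (2 * (C + L + 1))) := by
        have : Set.Ioo (0:ℝ) (min (min h1 (min δ β)) (ε / (2 * (C + L + 1)))) ∈ 𝓝[>] (0:ℝ) :=
          Ioo_mem_nhdsGT (lt_min (lt_min hh1 (lt_min hδ hβ0)) (by positivity))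
        filter_upwards [this] with h hh using ⟨hh.1, hh.2⟩
      obtain ⟨h, hev, hh0, hh⟩ := ((hDCT.eventually (lt_mem_nhds
        (show -(ε / 2) < (0:ℝ) by linarith))).and hsm2).exists
      have hhm : h < min h1 (min δ β) := hh.trans_le (min_le_left _ _)
      have hhβ : h < β := hhm.trans_le ((min_le_right _ _).trans (min_le_right _ _))
      have hhδ : h < δ := hhm.trans_le ((min_le_right _ _).trans (min_le_left _ _))
      have hhε : (C + L) * h ≤ ε / 2 := by
        have h9 := hh.trans_le (min_le_right _ _)
        rw [lt_div_iff₀ (by positivity)] at h9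
        nlinarith
      refine ⟨h, hh0, by linarith, ?_⟩
      have e1 : G (s + h) - G s = ∫ a in (β - h)..(β + δ - h), F h a := by
        have i1 := hint (s + h) (by linarith) (by linarith) (β - h) (β + δ - h) (by linarith)
          (by linarith) (by linarith) (by linarith)
        have i2 := (hint s hs (by linarith) (β - h + h) (β + δ - h + h) (by linarith)
          (by linarith) (by linarith) (by linarith)).comp_add_right h
        simp only [add_sub_cancel_right] at i2
        simp only [F]
        rw [integral_sub i1 i2, integral_comp_add_right (fun a => m a s)]
        simp only [G]
        congr 2 <;> ring
      have e2 : ∫ a in (β - h)..(β + δ - h), F h a =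
          (∫ a in (β - h)..β, F h a) + ∫ a in β..(β + δ - h), F h a :=
        (integral_add_adjacent_intervals
          (hFint h hh0 hhm _ _ (by linarith) (by linarith) (by linarith) (by linarith))
          (hFint h hh0 hhm _ _ (by linarith) (by linarith) (by linarith) (by linarith))).symm
      have e3 : -(C + L) * h * h ≤ ∫ a in (β - h)..β, F h a := by
        have := integral_mono_on (μ := volume) (a := β - h) (b := β) (f := fun _ => -(C + L) * h)
          (g := F h) (by linarith) (by simp)
          (hFint h hh0 hhm _ _ (by linarith) (by linarith) (by linarith) (by linarith))
          (fun a ha => hFlow h hh0 hhm a (by linarith [ha.1]) (by linarith [ha.2]))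
        simp at this
        linarith
      have i4 := hFint h hh0 hhm β (β + δ - h) hβ0.le (by linarith) (by linarith) (by linarith)
      have i5 : IntervalIntegrable (fun a => min (F h a / h) 0) volume β (β + δ - h) := by
        have := (i4.div_const h)
        rw [intervalIntegrable_iff_integrableOn_Ioc_of_le (by linarith)] at this ⊢
        exact this.inf (integrable_zero _ _ _)
      have e4 : h * ∫ a in β..(β + δ - h), min (F h a / h) 0 ≤ ∫ a in β..(β + δ - h), F h a := by
        rw [← intervalIntegral.integral_const_mul]
        refine integral_mono_on (by linarith) (i5.const_mul h) i4 fun a _ => ?_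
        have := mul_le_mul_of_nonneg_left (min_le_left (F h a / h) 0) hh0.le
        rwa [mul_div_cancel₀ _ hh0.ne'] at this
      have e5 : ∫ a in β..(β + δ), Φ h a = ∫ a in β..(β + δ - h), min (F h a / h) 0 := by
        rw [integral_of_le (by linarith), integral_of_le (by linarith)]
        have : Φ h = (Set.Iic (β + δ - h)).indicator (fun a => min (F h a / h) 0) := by
          funext a; simp [Φ, Set.indicator]
        rw [this, setIntegral_indicator measurableSet_Iic]
        congr 2
        ext a
        simp only [Set.mem_inter_iff, Set.mem_Ioc, Set.mem_Iic]
        constructor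
        · rintro ⟨⟨b1, b2⟩, b3⟩; exact ⟨b1, b3⟩
        · rintro ⟨b1, b2⟩; exact ⟨⟨b1, by linarith⟩, b2⟩
      rw [e5] at hev
      have e6 := mul_lt_mul_of_pos_left hev hh0
      nlinarith
    refine le_of_forall_pos_le_add fun η hη => ?_
    have := progress_right (ε := η / T) hT0.le hleft (hright (η / T) (by positivity))
    rw [div_mul_cancel₀ _ hT0.ne'] at this
    linarith
  obtain ⟨C0, hC00, hC0⟩ := hup 0 le_rfl ht.le
  obtain ⟨C1, hC10, hC1⟩ := hup t ht.le le_rfl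
  refine le_of_forall_pos_le_add fun η hη => ?_
  set K := C0 + C1 + L + 1
  have hK : 0 < K := by positivity
  obtain ⟨δ, hδ0, hδ⟩ := exists_between (lt_min (lt_min ht hh1) (div_pos hη hK))
  have hδt : δ < t := hδ.trans_le ((min_le_left _ _).trans (min_le_left _ _))
  have hδh : δ < h1 := hδ.trans_le ((min_le_left _ _).trans (min_le_right _ _))
  have hδK : δ * K < η := by
    have := hδ.trans_le (min_le_right _ _)
    rwa [lt_div_iff₀ hK] at this
  have hm := main δ hδ0 hδt
  have l1 : δ * (m t 0 - C0 * δ) ≤ ∫ r in (0:ℝ)..δ, m (r + (t - δ)) 0 := by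
    have i2 := (hint 0 le_rfl ht.le (0 + (t - δ)) (δ + (t - δ)) (by linarith)
          (by linarith) (by linarith) (by linarith)).comp_add_right (t - δ)
    simp only [add_sub_cancel_right] at i2
    have := integral_mono_on (μ := volume) (a := 0) (b := δ) (f := fun _ => m t 0 - C0 * δ)
      (g := fun r => m (r + (t - δ)) 0) hδ0.le (by simp) i2 (fun r hr => by
        have := hC0 (r + (t - δ)) t (by linarith [hr.1]) (by linarith [hr.2]) le_rfl
        have h3 : C0 * (t - (r + (t - δ))) ≤ C0 * δ :=
          mul_le_mul_of_nonneg_left (by linarith [hr.1]) hC00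
        linarith)
    simp at this
    nlinarith
  have l2 : ∫ r in (0:ℝ)..δ, m r (t - δ) ≤ δ * (m 0 t + C1 * δ + L * δ) := by
    have i2 := (hint (t - δ) (by linarith) (by linarith) 0 δ le_rfl ht.le hδ0.le hδt.le)
    have := integral_mono_on (μ := volume) (a := 0) (b := δ) 
      (f := fun r => m r (t - δ)) (g := fun _ => m 0 t + C1 * δ + L * δ) hδ0.le i2 (by simp)
      (fun r hr => by
        have h2 := hC1 0 r le_rfl hr.1 (by linarith [hr.2])
        have h3 := hlip r (t - δ) δ hr.1 (by linarith [hr.2]) (by linarith) (by linarith) hδ0.le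
          hδh.le
        rw [sub_add_cancel] at h3
        have h4 : C1 * (r - 0) ≤ C1 * δ :=
          mul_le_mul_of_nonneg_left (by linarith [hr.2]) hC10
        linarith [(abs_le.1 h3).1])
    simp at this
    nlinarith
  have l3 : m t 0 - C0 * δ ≤ m 0 t + C1 * δ + L * δ :=
    le_of_mul_le_mul_left (l1.trans (hm.trans l2)) hδ0
  have : (C0 + C1 + L) * δ ≤ δ * K := by simp only [K]; nlinarith
  linarith

end

section
variable {X : Type*} [MetricSpace X] {κ : X → ℝ}

lemma seq_of_not_GLex {g : ℝ → X → ℝ} {x : X} {c : ℝ}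
    (H : ¬ ∃ δ > 0, ∀ h, 0 < h → h < δ → ∀ y, dist y x < δ → g h y < c) :
    ∃ (h : ℕ → ℝ) (y : ℕ → X), (∀ n, 0 < h n) ∧ Tendsto h atTop (𝓝 0) ∧
      Tendsto y atTop (𝓝 x) ∧ ∀ n, c ≤ g (h n) (y n) := by
  push Not at H
  have hpos : ∀ n : ℕ, (0:ℝ) < 1 / ((n:ℝ) + 1) := fun n => by positivity
  choose h h1 h2 y h3 h4 using fun n : ℕ => H (1 / ((n:ℝ) + 1)) (hpos n)
  refine ⟨h, y, h1, ?_, ?_, h4⟩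
  · exact squeeze_zero (fun n => (h1 n).le) (fun n => (h2 n).le) tendsto_one_div_add_atTop_nhds_zero_nat
  · rw [tendsto_iff_dist_tendsto_zero]
    exact squeeze_zero (fun n => dist_nonneg) (fun n => (h3 n).le)
      tendsto_one_div_add_atTop_nhds_zero_nat

lemma GLex_of_compact {g : ℝ → X → ℝ} {g0 : X → ℝ} (hg0 : Continuous g0)
    (H : ∀ K : Set X, IsCompact K → ∀ ε > (0:ℝ), ∃ h₀ > (0:ℝ), ∀ h, 0 < h → h ≤ h₀ → ∀ x ∈ K,
      g h x ≤ g0 x + ε) : GLex g g0 := by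
  intro x c hc
  by_contra hn
  obtain ⟨h, y, hp, ht, hy, hge⟩ := seq_of_not_GLex hn
  obtain ⟨h₀, hh₀, hK⟩ := H _ hy.isCompact_insert_range ((c - g0 x) / 2) (by linarith)
  have e1 : ∀ᶠ n in atTop, h n < h₀ := ht.eventually_lt_const hh₀
  have e2 : ∀ᶠ n in atTop, g0 (y n) < g0 x + (c - g0 x) / 2 :=
    ((hg0.tendsto x).comp hy).eventually_lt_const (by linarith)
  obtain ⟨n, h1, h2⟩ := (e1.and e2).exists
  have := hK (h n) (hp n) h1.le (y n) (Set.mem_insert_of_mem _ ⟨n, rfl⟩)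
  linarith [hge n]

lemma uppGen_le {T : ℝ → (X → EReal) → (X → EReal)} {u : X → ℝ} {q : ℝ → X → ℝ} {W : X → ℝ}
    (hq : ∀ h, 0 < h → ∀ x, diffQuot T u h x = (q h x : EReal)) (hG : GLex q W) (x : X) :
    uppGen T u x ≤ (W x : EReal) := by
  unfold uppGen gammaLimsupZero gammaLimsup
  refine iSup_le fun h => iSup_le fun hp => iSup_le fun ht => iSup_le fun y => iSup_le fun hy => ?_
  refine EReal.le_of_forall_lt_iff_le.1 fun c hc => ?_
  obtain ⟨δ, hδ, hd⟩ := hG x c (by exact_mod_cast hc)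
  refine Filter.limsup_le_of_le (by isBoundedDefault) ?_
  have e1 : ∀ᶠ n in atTop, h n < δ := ht.eventually_lt_const hδ
  have e2 : ∀ᶠ n in atTop, dist (y n) x < δ :=
    (tendsto_iff_dist_tendsto_zero.1 hy).eventually_lt_const hδ
  filter_upwards [e1, e2] with n h1 h2
  rw [hq _ (hp n)]
  exact_mod_cast (hd (h n) (hp n) h1 (y n) h2).le

lemma GLex_of_uppGen {S : ℝ → (X → EReal) → (X → EReal)} {u : X → ℝ} {p : ℝ → X → ℝ} {W : X → ℝ}
    (hp : ∀ h, 0 < h → ∀ x, diffQuot S u h x = (p h x : EReal))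
    (hW : ∀ x, uppGen S u x ≤ (W x : EReal)) : GLex p W := by
  intro x c hc
  by_contra hn
  obtain ⟨h, y, h0, ht, hy, hge⟩ := seq_of_not_GLex hn
  have h1 : Filter.limsup (fun n => diffQuot S u (h n) (y n)) atTop ≤ uppGen S u x := by
    unfold uppGen gammaLimsupZero gammaLimsup
    exact le_iSup_of_le h (le_iSup_of_le h0 (le_iSup_of_le ht (le_iSup_of_le y
      (le_iSup_of_le hy le_rfl))))
  have h2 : Filter.limsup (fun n => diffQuot S u (h n) (y n)) atTop < (c : EReal) :=
    (h1.trans (hW x)).trans_lt (by exact_mod_cast hc)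
  obtain ⟨n, hn⟩ := (Filter.eventually_lt_of_limsup_lt h2).exists
  rw [hp _ (h0 n)] at hn
  have : p (h n) (y n) < c := by exact_mod_cast hn
  linarith [hge n]

lemma diffQuot_real (hκc : Continuous κ) (hκ : ∀ x, 0 < κ x) {S : ℝ → (X → EReal) → (X → EReal)}
    (hS : AssumptionS κ S) {u : X → ℝ} (hu : URx κ u) {h : ℝ} (h0 : 0 < h) (x : X) :
    diffQuot S u h x = (((realOp S h u x - u x) / h : ℝ) : EReal) := by
  unfold diffQuot
  rw [realOp_coe hκc hκ hS h0.le hu, ecoe, ← EReal.coe_sub, ← EReal.coe_mul, div_eq_inv_mul]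

lemma IsCk.real {S : ℝ → (X → EReal) → (X → EReal)} {t : ℝ} {f : X → ℝ}
    (h : IsCk κ (S t (ecoe f))) : MemCk κ (realOp S t f) := by
  obtain ⟨g, hg, he⟩ := h
  have : realOp S t f = g := by funext x; simp [realOp, he]
  rwa [this]

lemma semi_real (hκc : Continuous κ) (hκ : ∀ x, 0 < κ x) {S : ℝ → (X → EReal) → (X → EReal)}
    (hS : AssumptionS κ S) {u : X → ℝ} (hu : URx κ u) {s t : ℝ} (ht : 0 ≤ t)
    (h : S (s + t) (ecoe u) = S s (S t (ecoe u))) :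
    realOp S (s + t) u = realOp S s (realOp S t u) := by
  unfold realOp
  rw [h]
  rw [realOp_coe hκc hκ hS ht hu]
  rfl

lemma MemCk.quot {v w : X → ℝ} (hκ : ∀ x, 0 < κ x) (hv : MemCk κ v) (hw : MemCk κ w) (h : ℝ) :
    MemCk κ (fun x => (v x - w x) / h) := by
  obtain ⟨r, hr⟩ := hv.2
  obtain ⟨r', hr'⟩ := hw.2
  refine ⟨(hv.1.sub hw.1).div_const h, (r + r') / |h|, fun x => ?_⟩
  rw [abs_div, div_mul_eq_mul_div]
  refine div_le_div_of_nonneg_right ?_ (abs_nonneg h)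
  have := mul_le_mul_of_nonneg_right (abs_sub (v x) (w x)) (hκ x).le
  linarith [hr x, hr' x]

end
/-- comparison of two semigroups via their upper `Γ`-generators. -/
theorem stmt15
    {X : Type*} [MetricSpace X] [CompleteSpace X] [TopologicalSpace.SeparableSpace X]
    (κ : X → ℝ) (hκc : Continuous κ) (hκpos : ∀ x, 0 < κ x) (hκbd : ∃ C, ∀ x, κ x ≤ C)
    (S Tf : ℝ → (X → EReal) → (X → EReal))
    (hS : AssumptionS κ S) (hT : AssumptionS κ Tf)
    (D : Set (X → ℝ))
    (hD : ∀ f ∈ D, LipSet κ Tf f ∧ UpperLip κ S f)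
    (hinv : ∀ t, 0 ≤ t → ∀ f ∈ D, ∀ g : X → ℝ, (∀ x, Tf t (ecoe f) x = (g x : EReal)) → g ∈ D)
    (hgen : ∀ f ∈ D, ∀ x, uppGen S f x ≤ uppGen Tf f x)
    (f : X → ℝ) (hfD : f ∈ D)
    (Bf : X → ℝ) (hBfC : MemCk κ Bf) (hBf : MixedDeriv κ Tf f Bf) :
    ∀ t, 0 ≤ t → ∀ x, S t (ecoe f) x ≤ Tf t (ecoe f) x := by
  have RS' := realOp_RSx hκc hκpos hS
  have RT' := realOp_RSx hκc hκpos hT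
  obtain ⟨hLT, -⟩ := hD f hfD
  have hfC : MemCk κ f := hLT.1
  have hfU : URx κ f := URx.of_cont hfC
  intro t ht x
  rw [realOp_coe hκc hκpos hS ht hfU, realOp_coe hκc hκpos hT ht hfU]
  unfold ecoe
  rw [EReal.coe_le_coe_iff]
  rcases ht.eq_or_lt with rfl | htp
  · rw [RS'.zero f hfU, RT'.zero f hfU]
  -- the trajectory of the second semigroup
  have huC : ∀ s, 0 ≤ s → MemCk κ (realOp Tf s f) := fun s hs => (hLT.2.1 s hs).real
  have huU : ∀ s, 0 ≤ s → URx κ (realOp Tf s f) := fun s hs => URx.of_cont (huC s hs)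
  have huD : ∀ s, 0 ≤ s → realOp Tf s f ∈ D := fun s hs =>
    hinv s hs f hfD _ (fun y => congrFun (realOp_coe hκc hκpos hT hs hfU) y)
  have hTsemi : ∀ s h, 0 ≤ s → 0 ≤ h →
      realOp Tf (s + h) f = realOp Tf s (realOp Tf h f) := fun s h hs hh =>
    semi_real hκc hκpos hT hfU hh (hLT.2.2.1 s h hs hh)
  have hSC : ∀ s a, 0 ≤ s → 0 ≤ a → MemCk κ (realOp S a (realOp Tf s f)) := fun s a hs ha =>
    ((hD _ (huD s hs)).2.2.1 a ha).real
  have hSsemi : ∀ s a h, 0 ≤ s → 0 ≤ a → 0 ≤ h →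
      realOp S (a + h) (realOp Tf s f) = realOp S a (realOp S h (realOp Tf s f)) :=
    fun s a h hs ha hh =>
      semi_real hκc hκpos hS (huU s hs) hh ((hD _ (huD s hs)).2.2.2.1 a h ha hh)
  have hSup : ∀ s, 0 ≤ s → ∃ h₀ > (0:ℝ), ∃ c ≥ (0:ℝ), ∀ h, 0 ≤ h → h ≤ h₀ → ∀ y,
      (realOp S h (realOp Tf s f) y - realOp Tf s f y) * κ y ≤ c * h := by
    intro s hs
    obtain ⟨h₀, hh₀, c, hc, H⟩ := (hD _ (huD s hs)).2.2.2.2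
    refine ⟨h₀, hh₀, c, hc, fun h h1 h2 y => ?_⟩
    have h3 := H h h1 h2 y
    rw [realOp_coe hκc hκpos hS h1 (huU s hs), ecoe, ← EReal.coe_sub] at h3
    have h4 : (((realOp S h (realOp Tf s f) y - realOp Tf s f y) * κ y : ℝ) : EReal) ≤
        ((c * h : ℝ) : EReal) := by
      rw [EReal.coe_mul]
      refine le_trans ?_ h3
      exact mul_le_mul_of_nonneg_right (le_max_left _ _) (by exact_mod_cast (hκpos y).le)
    exact_mod_cast h4
  -- difference quotients of the second semigroup
  obtain ⟨⟨h0, hh0, r, hr⟩, hunif⟩ := hBf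
  let b : ℝ → X → ℝ := fun h y => (realOp Tf h f y - f y) / h
  have hbr : ∀ h, 0 < h → h < h0 → ∀ y, |b h y| * κ y ≤ r := by
    intro h a1 a2 y
    have := hr h a1 a2.le y
    rw [← div_eq_inv_mul] at this
    exact this
  have hbu : ∀ K : Set X, IsCompact K → ∀ ε > (0:ℝ), ∃ h₀ > (0:ℝ), ∀ h, 0 < h → h ≤ h₀ →
      ∀ y ∈ K, |b h y - Bf y| ≤ ε := by
    intro K hK ε hε
    obtain ⟨h₀, hh₀, H⟩ := hunif K hK ε hε
    refine ⟨h₀, hh₀, fun h a1 a2 y hy => ?_⟩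
    have := H h a1 a2 y hy
    rw [← div_eq_inv_mul] at this
    exact this
  have hG1 : GLex b Bf := by
    refine GLex_of_compact hBfC.1 fun K hK ε hε => ?_
    obtain ⟨h₀, hh₀, H⟩ := hbu K hK ε hε
    refine ⟨h₀, hh₀, fun h a1 a2 y hy => ?_⟩
    linarith [(abs_le.1 (H h a1 a2 y hy)).2]
  have hG2 : GLex (fun h y => Bf y - b h y) (fun _ => 0) := by
    refine GLex_of_compact continuous_const fun K hK ε hε => ?_
    obtain ⟨h₀, hh₀, H⟩ := hbu K hK ε hε
    refine ⟨h₀, hh₀, fun h a1 a2 y hy => ?_⟩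
    linarith [(abs_le.1 (H h a1 a2 y hy)).1]
  have hb : ∀ h, 0 < h → MemCk κ (b h) := fun h a1 => (huC h a1.le).quot hκpos hfC h
  have hfb : ∀ h, 0 < h → (fun y => f y + h * b h y) = realOp Tf h f := by
    intro h a1
    funext y
    simp only [b]
    field_simp
    ring
  have hTb : ∀ s h, 0 ≤ s → 0 < h →
      realOp Tf s (fun y => f y + h * b h y) = realOp Tf (s + h) f := by
    intro s h hs a1
    rw [hfb h a1, hTsemi s h hs a1.le]
  -- uniform bounds
  obtain ⟨rf, hrf⟩ := hfC.2
  obtain ⟨C1, hC10, hC1⟩ := RT'.bdd rf t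
  obtain ⟨C2, hC20, hC2⟩ := RT'.lip hκc hκpos (max rf r) t
  have hqb : ∀ s h, 0 ≤ s → s ≤ t → 0 < h → h < h0 → h ≤ 1 → ∀ y,
      |(realOp Tf (s + h) f y - realOp Tf s f y) / h| * κ y ≤ C2 := by
    intro s h hs hst a1 a2 a3 y
    have := hC2 s hs hst f (b h) hfU (URx.of_cont (hb h a1)) (fun y => (hrf y).trans (le_max_left _ _))
      (fun y => (hbr h a1 a2 y).trans (le_max_right _ _)) h a1.le a3 y
    rw [hTb s h hs a1] at this
    rw [abs_div, abs_of_pos a1, div_mul_eq_mul_div, div_le_iff₀ a1]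
    exact this
  obtain ⟨C3, hC30, hC3⟩ := RS'.lip hκc hκpos (max C1 C2) t
  have key := final_real (m := fun a s => realOp S a (realOp Tf s f) x) (t := t) htp
    (L := C3 / κ x) (h1 := min (h0 / 2) 1) (div_nonneg hC30 (hκpos x).le)
    (lt_min (by positivity) zero_lt_one) ?_ ?_ ?_
  · skip
    rw [RT'.zero f hfU, RS'.zero _ (huU t ht)] at key
    exact key
  · -- Lipschitz continuity in the second variable
    intro a s h ha hat hs hst hh hh1
    rcases hh.eq_or_lt with rfl | hhp
    · simp
    have k1 : h < h0 := by
      have := hh1.trans (min_le_left _ _)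
      linarith
    have k2 : h ≤ 1 := hh1.trans (min_le_right _ _)
    have hst' : s ≤ t := by linarith
    have := hC3 a ha hat (realOp Tf s f)
      (fun y => (realOp Tf (s + h) f y - realOp Tf s f y) / h) (huU s hs)
      (URx.of_cont ((huC (s + h) (by linarith)).quot hκpos (huC s hs) h))
      (fun y => (hC1 s hs hst' f hfU hrf y).trans (le_max_left _ _))
      (fun y => (hqb s h hs hst' hhp k1 k2 y).trans (le_max_right _ _)) h hh k2 x
    have e : (fun y => realOp Tf s f y + h * ((realOp Tf (s + h) f y - realOp Tf s f y) / h)) =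
        realOp Tf (s + h) f := by
      funext y; field_simp; ring
    rw [e, ← le_div_iff₀ (hκpos x)] at this
    rw [div_mul_eq_mul_div]
    exact this
  · -- upper Lipschitz estimate in the first variable
    intro s hs hst
    obtain ⟨h₀, hh₀, c, hc, H⟩ := hSup s hs
    obtain ⟨C4, hC40, hC4⟩ := RS'.lip hκc hκpos (max C1 c) t
    refine ⟨C4 / κ x, div_nonneg hC40 (hκpos x).le, ?_⟩
    refine chain_antitone (m := fun a => realOp S a (realOp Tf s f) x) (h0 := min h₀ 1)
      (lt_min hh₀ zero_lt_one) ?_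
    intro a h ha hat hh hh1
    have k1 : h ≤ h₀ := hh1.trans (min_le_left _ _)
    have k2 : h ≤ 1 := hh1.trans (min_le_right _ _)
    have i1 := hC4 a ha hat (realOp Tf s f) (fun y => c / κ y) (huU s hs) (invk_UR hκc hκpos c)
      (fun y => (hC1 s hs hst f hfU hrf y).trans (le_max_left _ _))
      (fun y => by
        rw [abs_div, abs_of_pos (hκpos y), div_mul_cancel₀ _ (hκpos y).ne', abs_of_nonneg hc]
        exact le_max_right _ _) h hh k2 x
    have i2 := RS'.mono a ha (realOp S h (realOp Tf s f))
      (fun y => realOp Tf s f y + h * (c / κ y)) (URx.of_cont (hSC s h hs hh))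
      ((huU s hs).add_smul hκpos (invk_UR hκc hκpos c) hh) (fun y => by
        have := H h hh k1 y
        rw [← le_div_iff₀ (hκpos y)] at this
        have e : h * (c / κ y) = c * h / κ y := by ring
        rw [e]
        linarith) x
    rw [← le_div_iff₀ (hκpos x)] at i1
    rw [hSsemi s a h hs ha hh]
    have := (abs_le.1 i1).2
    rw [div_mul_eq_mul_div]
    linarith
  · -- infinitesimal comparison
    intro a s ε ha hat hs hst hε
    obtain ⟨h₀, hh₀, c, hc, H⟩ := hSup s hs
    let p : ℝ → X → ℝ := fun h y => (realOp S h (realOp Tf s f) y - realOp Tf s f y) / h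
    obtain ⟨δ, hδ, hd⟩ := dini_compare hκc hκpos RS' RT' hfC hBfC hh0 (fun h a1 _ => hb h a1) hbr
      hG1 hG2 hs ha (u := realOp Tf s f) rfl (huC s hs) (hSC s a hs ha) (p := p) (c := c) hh₀
      (fun h a1 _ => URx.of_cont ((hSC s h hs a1.le).quot hκpos (huC s hs) h))
      (fun h a1 a2 y => by
        simp only [p]
        rw [div_mul_eq_mul_div, div_le_iff₀ a1]
        exact H h a1.le a2.le y)
      (fun W hW => by
        refine GLex_of_uppGen (S := S) (u := realOp Tf s f)
          (fun h a1 y => diffQuot_real hκc hκpos hS (huU s hs) a1 y) fun y => ?_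
        refine (hgen _ (huD s hs) y).trans ?_
        refine uppGen_le (fun h a1 z => ?_) hW y
        rw [diffQuot_real hκc hκpos hT (huU s hs) a1 z, hTb s h hs a1, add_comm s h,
          hTsemi h s a1.le hs])
      (fun h a1 _ => by
        rw [hTb s h hs a1]
        exact huC _ (by linarith)) x hε
    refine ⟨δ, hδ, fun h a1 a2 => ?_⟩
    have i := hd h a1 a2
    have e : (fun y => realOp Tf s f y + h * p h y) = realOp S h (realOp Tf s f) := by
      funext y
      simp only [p]
      field_simp
      ring
    rw [e, hTb s h hs a1, ← hSsemi s a h hs ha a1.le] at i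
    exact i
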